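/- Suppose the meromorphic mapping Φ = (φ₁,…,φ_n) admits an algebraic addition theorem and let θ be a primitive element as described. Then for every k ∈ {1,…,n} and every fixed b ∈ ℂⁿ at which all φ_j are analytic, the translated function u ↦ φ_k(u+b) is a rational function of θ(u), φ₁(u),…,φ_n(u): there exist polynomials A, B ∈ ℂ[t, x₁,…,x_n] with B(θ(u); φ₁(u),…,φ_n(u)) not identically zero, such that φ_k(u+b) = A(θ(u); φ₁(u),…,φ_n(u)) / B(θ(u); φ₁(u),…,φ_n(u)) for every u at which all the functions involved are analytic and the denominator is nonzero. -/

import Mathlib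

open MvPolynomial

/-- The partial derivative `∂f/∂u_p` of a function on ℂⁿ. -/
noncomputable def pd {n : ℕ} (f : (Fin n → ℂ) → ℂ) (p : Fin n) (u : Fin n → ℂ) : ℂ :=
  fderiv ℂ f u (Pi.single p 1)

/-- `f` is meromorphic on ℂⁿ: a quotient of two everywhere-analytic functions. -/
def Mero {n : ℕ} (f : (Fin n → ℂ) → ℂ) : Prop :=
  ∃ g h : (Fin n → ℂ) → ℂ, (∀ u, AnalyticAt ℂ g u) ∧ (∀ u, AnalyticAt ℂ h u) ∧
    (∃ u, h u ≠ 0) ∧ ∀ u, h u ≠ 0 → f u = g u / h u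

/-- The Jacobian determinant of the family `φ` is not identically zero. -/
def AnalyticallyIndep {n : ℕ} (φ : Fin n → (Fin n → ℂ) → ℂ) : Prop :=
  ∃ u : Fin n → ℂ, (∀ j, AnalyticAt ℂ (φ j) u) ∧
    Matrix.det (Matrix.of fun k p => pd (φ k) p u) ≠ 0

/-- `Φ = (φ₁,…,φ_n)` admits an algebraic addition theorem: for each `k` there is a
polynomial `G_k` in the variables `λ` (= `none`), `x_j` (= `some (inl j)`) and
`y_j` (= `some (inr j)`), of degree ≥ 1 in `λ`, with
`G_k(φ_k(u+v); φ(u), φ(v)) = 0` wherever all functions involved are analytic. -/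
def AdmitsAAT {n : ℕ} (φ : Fin n → (Fin n → ℂ) → ℂ) : Prop :=
  ∀ k : Fin n, ∃ G : MvPolynomial (Option (Fin n ⊕ Fin n)) ℂ,
    1 ≤ G.degreeOf none ∧
    ∀ u v : Fin n → ℂ, (∀ j, AnalyticAt ℂ (φ j) u) → (∀ j, AnalyticAt ℂ (φ j) v) →
      AnalyticAt ℂ (φ k) (u + v) →
      eval (fun i => i.elim (φ k (u + v)) (Sum.elim (fun j => φ j u) fun j => φ j v)) G = 0

/-- The valuation sending the variable `none` to `θ(u)` and `some j` to `φ_j(u)`. -/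
noncomputable def tval {n : ℕ} (θ : (Fin n → ℂ) → ℂ) (φ : Fin n → (Fin n → ℂ) → ℂ)
    (u : Fin n → ℂ) : Option (Fin n) → ℂ :=
  fun i => i.elim (θ u) fun j => φ j u

/-- `f` is a rational function on ℂⁿ. -/
def RatFn {n : ℕ} (f : (Fin n → ℂ) → ℂ) : Prop :=
  ∃ P Q : MvPolynomial (Fin n) ℂ, Q ≠ 0 ∧
    ∃ s : Set (Fin n → ℂ), IsOpen s ∧ s.Nonempty ∧
      ∀ u ∈ s, f u = eval u P / eval u Q

section Part1
open MvPolynomial Filter Topology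

/-- identity theorem along complex lines, on convex open sets -/
theorem ident {ι : Type*} [Fintype ι] {s : Set (ι → ℂ)} (hs : Convex ℝ s) (ho : IsOpen s)
    {f : (ι → ℂ) → ℂ} (hf : DifferentiableOn ℂ f s) {x : ι → ℂ} (hx : x ∈ s)
    (h : ∀ᶠ y in 𝓝 x, f y = 0) : ∀ y ∈ s, f y = 0 := by
  intro y hy
  set l : ℂ → (ι → ℂ) := fun z => x + z • (y - x) with hl
  have hld : Differentiable ℂ l := by fun_prop
  have h0 : l 0 = x := by simp [hl]
  have h1 : l 1 = y := by simp [hl]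
  have hpo : IsOpen (l ⁻¹' s) := ho.preimage hld.continuous
  have hpc : Convex ℝ (l ⁻¹' s) := by
    intro z hz w hw a b ha hb hab
    have : l (a • z + b • w) = a • l z + b • l w := by
      simp only [hl]
      ext i
      simp only [Pi.add_apply, Pi.smul_apply, Pi.sub_apply, smul_eq_mul, Complex.real_smul]
      have : (a : ℂ) + b = 1 := by exact_mod_cast hab
      linear_combination (-x i) * this
    show l _ ∈ s
    rw [this]
    exact hs hz hw ha hb hab
  have han : AnalyticOnNhd ℂ (f ∘ l) (l ⁻¹' s) := by
    apply DifferentiableOn.analyticOnNhd _ hpo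
    exact hf.comp hld.differentiableOn (fun z hz => hz)
  have hz : (0 : ℂ) ∈ l ⁻¹' s := by show l 0 ∈ s; rwa [h0]
  have h1' : (1 : ℂ) ∈ l ⁻¹' s := by show l 1 ∈ s; rwa [h1]
  have hev : (f ∘ l) =ᶠ[𝓝 0] 0 := by
    have : Tendsto l (𝓝 0) (𝓝 x) := by
      rw [← h0]; exact hld.continuous.continuousAt
    exact this.eventually h
  have := han.eqOn_zero_of_preconnected_of_eventuallyEq_zero hpc.isPreconnected hz hev h1'
  simpa [h1] using this

/-- a nonzero function is frequently nonzero -/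
theorem ident_dense {ι : Type*} [Fintype ι] {s : Set (ι → ℂ)} (hs : Convex ℝ s) (ho : IsOpen s)
    {f : (ι → ℂ) → ℂ} (hf : DifferentiableOn ℂ f s) (hne : ∃ y ∈ s, f y ≠ 0) {x : ι → ℂ}
    (hx : x ∈ s) : ∃ᶠ y in 𝓝 x, f y ≠ 0 := by
  intro h
  obtain ⟨y, hy, hy'⟩ := hne
  exact hy' (ident hs ho hf hx (h.mono fun y hy => not_not.1 hy) y hy)

theorem ident_mul {ι : Type*} [Fintype ι] {s : Set (ι → ℂ)} (hs : Convex ℝ s) (ho : IsOpen s)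
    {f g : (ι → ℂ) → ℂ} (hf : DifferentiableOn ℂ f s) (hg : DifferentiableOn ℂ g s)
    (hfn : ∃ y ∈ s, f y ≠ 0) (hgn : ∃ y ∈ s, g y ≠ 0) : ∃ y ∈ s, f y * g y ≠ 0 := by
  obtain ⟨y, hy, hy'⟩ := hfn
  have h1 := ident_dense hs ho hg hgn hy
  have h2 : ∀ᶠ z in 𝓝 y, f z ≠ 0 :=
    (hf.continuousOn.continuousAt (ho.mem_nhds hy)).eventually_ne hy'
  have h3 : ∀ᶠ z in 𝓝 y, z ∈ s := ho.mem_nhds hy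
  obtain ⟨z, hz, hz2, hz3⟩ := (h1.and_eventually (h2.and h3)).exists
  exact ⟨z, hz3, mul_ne_zero hz2 hz⟩

/-- If an identity between continuous functions holds wherever `H ≠ 0`, it holds everywhere. -/
theorem eq_of_dense {X : Type*} [TopologicalSpace X] {f g : X → ℂ} {x : X}
    (hf : ContinuousAt f x) (hg : ContinuousAt g x) (h : ∃ᶠ y in 𝓝 x, f y = g y) : f x = g x := by
  by_contra hne
  have : ∀ᶠ y in 𝓝 x, f y - g y ≠ 0 :=
    (hf.sub hg).eventually_ne (sub_ne_zero.2 hne)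
  obtain ⟨y, hy, hy'⟩ := (h.and_eventually this).exists
  exact hy' (sub_eq_zero.2 hy)

/-! ### Liouville -/
theorem liouville_one {f : ℂ → ℂ} (hf : Differentiable ℂ f) {C : ℝ} {M : ℕ}
    (hb : ∀ z, ‖f z‖ ≤ C * (1 + ‖z‖) ^ M) : ∃ p : Polynomial ℂ, p.natDegree ≤ M ∧ ∀ z, f z = p.eval z := by
  have hz : ∀ m, M < m → iteratedDeriv m f 0 = 0 := by
    intro m hm
    have key : ∀ R : ℝ, 1 ≤ R → ‖iteratedDeriv m f 0‖ ≤ (m.factorial * C * 2 ^ M) * R⁻¹ := by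
      intro R hR
      have hR0 : 0 < R := by linarith
      have hC : 0 ≤ C := by
        have := hb 0
        simp at this
        exact (norm_nonneg _).trans this
      have := Complex.norm_iteratedDeriv_le_of_forall_mem_sphere_norm_le (C := C * (2 * R) ^ M) (f := f) (c := 0) m hR0
        hf.diffContOnCl (by
          intro z hz
          have hz' : ‖z‖ = R := by simpa using hz
          refine (hb z).trans ?_
          gcongr
          rw [hz']; linarith)
      refine this.trans ?_
      obtain ⟨j, rfl⟩ : ∃ j, m = M + 1 + j := ⟨m - (M+1), by omega⟩
      rw [div_le_iff₀ (by positivity)]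
      have h1 : R ^ (M+1+j) = R^M * R * R^j := by ring
      rw [h1, mul_pow]
      have h2 : 1 ≤ R ^ j := one_le_pow₀ hR
      have h3 : (↑(M + 1 + j).factorial * C * 2 ^ M) * R⁻¹ * (R^M * R * R^j) = (↑(M + 1 + j).factorial * (C * (2^M * R^M))) * R^j := by
        field_simp
      rw [h3]
      exact le_mul_of_one_le_right (by positivity) h2
    have hlim : Tendsto (fun R : ℝ => (m.factorial * C * 2 ^ M) * R⁻¹) atTop (𝓝 0) := by
      simpa using (tendsto_inv_atTop_zero (𝕜 := ℝ)).const_mul (m.factorial * C * 2 ^ M)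
    have : ‖iteratedDeriv m f 0‖ ≤ 0 :=
      ge_of_tendsto hlim ((eventually_ge_atTop 1).mono key)
    simpa using this
  refine ⟨∑ m ∈ Finset.range (M+1), Polynomial.C ((m.factorial : ℂ)⁻¹ * iteratedDeriv m f 0) * Polynomial.X ^ m, ?_, ?_⟩
  · refine Polynomial.natDegree_sum_le_of_forall_le _ _ ?_
    intro i hi
    refine (Polynomial.natDegree_C_mul_X_pow_le _ _).trans ?_
    have := Finset.mem_range.1 hi
    omega
  · intro z
    have h := Complex.taylorSeries_eq_of_entire' 0 z hf
    rw [← h, tsum_eq_sum (s := Finset.range (M+1))]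
    · simp [Polynomial.eval_finsetSum]
    · intro m hm
      have := hz m (by simpa using hm)
      rw [this]; simp

theorem liouville_fin : ∀ (n : ℕ) (f : (Fin n → ℂ) → ℂ), Differentiable ℂ f → ∀ (C : ℝ) (M : ℕ),
    (∀ z, ‖f z‖ ≤ C * (1 + ‖z‖) ^ M) → ∃ p : MvPolynomial (Fin n) ℂ, ∀ z, f z = eval z p
  | 0, f, _, _, _, _ => ⟨MvPolynomial.C (f 0), fun z => by
      rw [eval_C]; congr 1; exact Subsingleton.elim _ _⟩
  | n+1, f, hf, C, M, hb => by
    have hC : 0 ≤ C := by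
      have := hb 0
      simp at this
      exact (norm_nonneg _).trans this
    have hcons1 : ∀ a : Fin n → ℂ, Differentiable ℂ (fun t : ℂ => (Fin.cons t a : Fin (n+1) → ℂ)) := by
      intro a
      rw [differentiable_pi]
      intro i
      refine Fin.cases ?_ (fun j => ?_) i
      · simp
      · simp
    have hcons2 : ∀ t : ℂ, Differentiable ℂ (fun a : Fin n → ℂ => (Fin.cons t a : Fin (n+1) → ℂ)) := by
      intro a
      rw [differentiable_pi]
      intro i
      refine Fin.cases ?_ (fun j => ?_) i
      · simp
      · simp only [Fin.cons_succ]; fun_prop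
    have hnorm : ∀ (t : ℂ) (a : Fin n → ℂ), 1 + ‖(Fin.cons t a : Fin (n+1) → ℂ)‖ ≤ (1 + ‖t‖) * (1 + ‖a‖) := by
      intro t a
      have : ‖(Fin.cons t a : Fin (n+1) → ℂ)‖ ≤ ‖t‖ + ‖a‖ := by
        rw [pi_norm_le_iff_of_nonneg (by positivity)]
        intro i
        refine Fin.cases ?_ (fun j => ?_) i
        · simp
        · simp only [Fin.cons_succ]
          have := norm_le_pi_norm a j
          have := norm_nonneg t
          linarith
      nlinarith [norm_nonneg t, norm_nonneg a, mul_nonneg (norm_nonneg t) (norm_nonneg a)]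
    -- polynomial in the first variable
    have h1 : ∀ a : Fin n → ℂ, ∃ p : Polynomial ℂ, p.natDegree ≤ M ∧ ∀ t, f (Fin.cons t a) = p.eval t := by
      intro a
      refine liouville_one (C := C * (1 + ‖a‖)^M) (hf.comp (hcons1 a)) ?_
      intro z
      refine (hb _).trans ?_
      calc C * (1 + ‖(Fin.cons z a : Fin (n+1) → ℂ)‖)^M ≤ C * ((1 + ‖z‖) * (1 + ‖a‖))^M := by
            gcongr; exact hnorm _ _
        _ = _ := by rw [mul_pow]; ring
    have h2 : ∀ t : ℂ, ∃ p : MvPolynomial (Fin n) ℂ, ∀ a, f (Fin.cons t a) = eval a p := by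
      intro t
      refine liouville_fin n _ (hf.comp (hcons2 t)) (C * (1 + ‖t‖)^M) M ?_
      intro z
      refine (hb _).trans ?_
      calc C * (1 + ‖(Fin.cons t z : Fin (n+1) → ℂ)‖)^M ≤ C * ((1 + ‖t‖) * (1 + ‖z‖))^M := by
            gcongr; exact hnorm _ _
        _ = _ := by rw [mul_pow]; ring
    choose q hq using h2
    let v : ℕ → ℂ := fun i => (i : ℂ)
    have hv : Set.InjOn v (Finset.range (M+1)) := fun i _ j _ h => by simpa [v] using h
    refine ⟨∑ i ∈ Finset.range (M+1), rename Fin.succ (q i) *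
      Polynomial.aeval (X 0) (Lagrange.basis (Finset.range (M+1)) v i), ?_⟩
    intro z
    obtain ⟨p, hp, hp'⟩ := h1 (Fin.tail z)
    have h3 : p = Lagrange.interpolate (Finset.range (M+1)) v (fun i => p.eval (v i)) := by
      apply Lagrange.eq_interpolate hv
      rw [Finset.card_range]
      exact lt_of_le_of_lt Polynomial.degree_le_natDegree (by exact_mod_cast Nat.lt_succ_of_le hp)
    have h4 : f z = p.eval (z 0) := by
      rw [← hp', Fin.cons_self_tail]
    rw [h4, h3, Lagrange.interpolate_apply, Polynomial.eval_finsetSum, map_sum]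
    refine Finset.sum_congr rfl fun i _ => ?_
    rw [map_mul, eval_rename, Polynomial.eval_mul, Polynomial.eval_C, ← hp', hq]
    congr 1
    rw [Polynomial.aeval_def, Polynomial.hom_eval₂, eval_X]
    have : (eval z).comp (algebraMap ℂ (MvPolynomial (Fin (n+1)) ℂ)) = RingHom.id ℂ := by
      ext t; simp
    rw [this]; rfl

theorem liouville_option {n : ℕ} (f : (Option (Fin n) → ℂ) → ℂ) (hf : Differentiable ℂ f) (C : ℝ) (M : ℕ)
    (hb : ∀ z, ‖f z‖ ≤ C * (1 + ‖z‖) ^ M) : ∃ p : MvPolynomial (Option (Fin n)) ℂ, ∀ z, f z = eval z p := by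
  let e := finSuccEquiv n
  have hd : Differentiable ℂ (fun z : Fin (n+1) → ℂ => (fun i => z (e.symm i))) := by
    rw [differentiable_pi]; intro i; fun_prop
  have hC : 0 ≤ C := by
    have := hb 0
    simp at this
    exact (norm_nonneg _).trans this
  obtain ⟨p, hp⟩ := liouville_fin (n+1) (fun z => f (fun i => z (e.symm i))) (hf.comp hd) C M (by
    intro z
    refine (hb _).trans ?_
    gcongr
    rw [pi_norm_le_iff_of_nonneg (by positivity)]
    intro i; exact norm_le_pi_norm z _)
  refine ⟨rename e p, fun z => ?_⟩
  rw [eval_rename, ← hp]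
  congr 1
  ext i
  simp

theorem poly_growth {ι : Type*} [Fintype ι] (P : MvPolynomial ι ℂ) :
    ∃ (C : ℝ) (M : ℕ), 0 ≤ C ∧ ∀ w : ι → ℂ, ‖eval w P‖ ≤ C * (1 + ‖w‖) ^ M := by
  induction P using MvPolynomial.induction_on with
  | C a => exact ⟨‖a‖, 0, norm_nonneg _, fun w => by simp⟩
  | add p q hp hq =>
    obtain ⟨C, M, hC, h⟩ := hp
    obtain ⟨C', M', hC', h'⟩ := hq
    refine ⟨C + C', M + M', by positivity, fun w => ?_⟩
    have h1 : (1:ℝ) ≤ 1 + ‖w‖ := by linarith [norm_nonneg w]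
    have h2 : (1 + ‖w‖)^M ≤ (1+‖w‖)^(M+M') := pow_le_pow_right₀ h1 (by omega)
    have h3 : (1 + ‖w‖)^M' ≤ (1+‖w‖)^(M+M') := pow_le_pow_right₀ h1 (by omega)
    rw [map_add]
    calc _ ≤ _ := norm_add_le _ _
      _ ≤ C * (1 + ‖w‖) ^ M + C' * (1 + ‖w‖) ^ M' := add_le_add (h w) (h' w)
      _ ≤ C * (1+‖w‖)^(M+M') + C' * (1+‖w‖)^(M+M') := by gcongr
      _ = _ := by ring
  | mul_X p i hp =>
    obtain ⟨C, M, hC, h⟩ := hp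
    refine ⟨C, M+1, hC, fun w => ?_⟩
    rw [map_mul, eval_X, norm_mul, pow_succ, ← mul_assoc]
    have := norm_le_pi_norm w i
    have h1 : ‖w i‖ ≤ 1 + ‖w‖ := by linarith
    have := h w
    gcongr

theorem eval_analyticAt {ι : Type*} [Fintype ι] (P : MvPolynomial ι ℂ) (w : ι → ℂ) :
    AnalyticAt ℂ (fun w => eval w P) w := by
  have := AnalyticAt.aeval_mvPolynomial (𝕜 := ℂ) (A := ℂ) (f := fun w : ι → ℂ => w) (z := w)
    (fun i => (ContinuousLinearMap.proj (R := ℂ) (φ := fun _ : ι => ℂ) i).analyticAt w) P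
  simpa [MvPolynomial.aeval_eq_eval] using this

theorem liouville_off {n : ℕ} (F : (Option (Fin n) → ℂ) → ℂ) (Q : MvPolynomial (Option (Fin n)) ℂ)
    (hF : ∀ w, eval w Q ≠ 0 → DifferentiableAt ℂ F w) (C : ℝ) (M : ℕ)
    (hb : ∀ w, eval w Q ≠ 0 → ‖F w‖ ≤ C * (1 + ‖w‖) ^ M) :
    ∃ p : MvPolynomial (Option (Fin n)) ℂ, ∀ w, (eval w Q) ^ 2 * F w = eval w p := by
  obtain ⟨C', M', hC', hQ⟩ := poly_growth Q
  have hqd : ∀ w, DifferentiableAt ℂ (fun w => eval w Q) w := fun w =>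
    (eval_analyticAt Q w).differentiableAt
  have hb' : ∀ w, eval w Q ≠ 0 → ‖F w‖ ≤ |C| * (1 + ‖w‖) ^ M := fun w hw =>
    (hb w hw).trans (by gcongr; exact le_abs_self C)
  apply liouville_option _ _ (C' ^ 2 * |C|) (M' + M' + M)
  · intro z
    by_cases hz : eval z Q = 0
    · rw [hz]; simp; positivity
    · rw [norm_mul, norm_pow]
      calc ‖eval z Q‖ ^ 2 * ‖F z‖ ≤ (C' * (1 + ‖z‖) ^ M')^2 * (|C| * (1 + ‖z‖)^M) := by
            have := hQ z
            have := hb' z hz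
            gcongr
        _ = _ := by ring
  · intro w
    by_cases hw : eval w Q = 0
    · have h1 : (fun z => eval z Q) =O[𝓝 w] (fun z => z - w) := by
        have := (hqd w).isBigO_sub
        simpa [hw] using this
      have h2 : (fun z => eval z Q) =o[𝓝 w] (fun _ => (1 : ℝ)) := by
        rw [Asymptotics.isLittleO_one_iff]
        have := (hqd w).continuousAt.tendsto
        simpa [hw] using this
      have h3 : (fun z => (eval z Q) ^ 2 * F z) =O[𝓝 w] (fun z => eval z Q * eval z Q) := by
        refine Asymptotics.IsBigO.of_bound (|C| * (2 + ‖w‖)^M) ?_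
        filter_upwards [Metric.ball_mem_nhds w one_pos] with z hz
        by_cases hz0 : eval z Q = 0
        · simp [hz0]
        · have hzw : 1 + ‖z‖ ≤ 2 + ‖w‖ := by
            have h5 : ‖z - w‖ < 1 := by simpa [dist_eq_norm] using hz
            have := norm_le_insert' z w
            linarith
          have h6 : ‖F z‖ ≤ |C| * (2 + ‖w‖)^M := (hb' z hz0).trans (by gcongr)
          rw [norm_mul, norm_mul, norm_pow]
          nlinarith [mul_le_mul_of_nonneg_left h6 (sq_nonneg ‖eval z Q‖)]
      have h4 : (fun z => (eval z Q) ^ 2 * F z) =o[𝓝 w] (fun z => z - w) := by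
        refine h3.trans_isLittleO ?_
        have := h2.mul_isBigO h1.norm_right
        refine Asymptotics.IsLittleO.of_norm_right ?_
        simpa using this
      have : HasFDerivAt (fun z => (eval z Q) ^ 2 * F z) (0 : (Option (Fin n) → ℂ) →L[ℂ] ℂ) w := by
        rw [hasFDerivAt_iff_isLittleO]
        simpa [hw] using h4
      exact this.differentiableAt
    · exact ((hqd w).pow 2).mul (hF w hw)

/-! ### algebra -/
open Polynomial in
theorem alg_lemma {R : Type*} [CommRing R] [IsDomain R] [CharZero R] (P D : Polynomial R) (hP : P ≠ 0) :
    ∃ (p T U W U' W' : Polynomial R) (q : R) (N : ℕ), q ≠ 0 ∧ p ≠ 0 ∧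
      P * T = Polynomial.C q * (p * D) ^ N ∧
      U * p + W * derivative p = Polynomial.C q ∧ U' * D + W' * p = Polynomial.C q := by
  classical
  let k := FractionRing R
  have hinj : Function.Injective (algebraMap R k) := IsFractionRing.injective R k
  have hminj : Function.Injective (Polynomial.mapRingHom (algebraMap R k)) :=
    Polynomial.map_injective _ hinj
  let m := Polynomial.mapRingHom (algebraMap R k)
  have : CharZero k := charZero_of_injective_algebraMap hinj
  have hP' : m P ≠ 0 := by
    intro h; exact hP (hminj (by rw [map_zero]; exact h))
  -- clear denominators
  have clr : ∀ f : Polynomial k, ∃ (b : R) (g : Polynomial R), b ≠ 0 ∧ m g = Polynomial.C (algebraMap R k b) * f := by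
    intro f
    obtain ⟨b, hb, h⟩ := IsLocalization.integerNormalization_spec (nonZeroDivisors R) f
    refine ⟨b, IsLocalization.integerNormalization (nonZeroDivisors R) f, nonZeroDivisors.ne_zero hb, ?_⟩
    show Polynomial.map _ _ = _
    rw [h, Algebra.smul_def]; rfl
  set rad := UniqueFactorizationMonoid.radical (m P) with hrad
  have hsq : Squarefree rad := UniqueFactorizationMonoid.squarefree_radical
  obtain ⟨N, hN⟩ := UniqueFactorizationMonoid.exists_dvd_radical_self_pow hP'
  obtain ⟨p0, hp0⟩ : EuclideanDomain.gcd rad (m D) ∣ rad := EuclideanDomain.gcd_dvd_left _ _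
  set g := EuclideanDomain.gcd rad (m D) with hg
  have hrad0 : rad ≠ 0 := hsq.ne_zero
  have hp00 : p0 ≠ 0 := by rintro rfl; simp at hp0; exact hrad0 hp0
  have hg0 : g ≠ 0 := by intro h; rw [h] at hp0; simp at hp0; exact hrad0 hp0
  have hgD : g ∣ m D := EuclideanDomain.gcd_dvd_right _ _
  have hsep : p0.Separable := by
    have : rad.Separable := PerfectField.separable_iff_squarefree.2 hsq
    rw [hp0] at this
    exact this.of_mul_right
  have hcop1 : IsCoprime p0 (m D) := by
    have h1 : IsCoprime g p0 := by
      have : rad.Separable := PerfectField.separable_iff_squarefree.2 hsq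
      rw [hp0] at this
      exact this.isCoprime
    obtain ⟨D1, hD1⟩ := hgD
    have h2 : IsCoprime p0 D1 := by
      obtain ⟨x, y, hxy⟩ : ∃ x y, x * p0 + y * D1 = 1 := by
        have := EuclideanDomain.gcd_eq_gcd_ab rad (m D)
        rw [← hg] at this
        generalize EuclideanDomain.gcdA rad (m D) = x at this
        generalize EuclideanDomain.gcdB rad (m D) = y at this
        refine ⟨x, y, ?_⟩
        apply mul_left_cancel₀ hg0
        linear_combination -this - x * hp0 - y * hD1
      exact ⟨x, y, hxy⟩
    rw [hD1]
    exact h1.symm.mul_right h2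
  obtain ⟨b0, p, hb0, hp⟩ := clr p0
  have hub : IsUnit (Polynomial.C (algebraMap R k b0)) := by
    rw [Polynomial.isUnit_C, isUnit_iff_ne_zero]
    intro h; exact hb0 (hinj (by simpa using h))
  have hpass : Associated p0 (m p) := by
    rw [hp, mul_comm]; exact (associated_mul_unit_right p0 _ hub)
  have hsep' : IsCoprime (m p) (m (derivative p)) := by
    have h1 : (m p).Separable := by
      exact hsep.of_dvd hpass.symm.dvd
    have h2 : m (derivative p) = derivative (m p) := by simp [m, Polynomial.derivative_map]
    rw [h2]; exact h1
  have hcop' : IsCoprime (m D) (m p) := by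
    have : IsCoprime (m D) p0 := hcop1.symm
    rw [hp]
    exact (isCoprime_mul_unit_left_right hub _ _).2 this
  have hdvd : m P ∣ (m p * m D) ^ N := by
    refine hN.trans (pow_dvd_pow_of_dvd ?_ N)
    rw [← hrad, hp0, mul_comm]
    exact mul_dvd_mul hpass.dvd hgD
  obtain ⟨t0, ht0⟩ := hdvd
  obtain ⟨u0, w0, huw⟩ := hsep'
  obtain ⟨u1, w1, huw'⟩ := hcop'
  obtain ⟨b1, T, hb1, hT⟩ := clr t0
  obtain ⟨b2, U, hb2, hU⟩ := clr u0
  obtain ⟨b3, W, hb3, hW⟩ := clr w0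
  obtain ⟨b4, U', hb4, hU'⟩ := clr u1
  obtain ⟨b5, W', hb5, hW'⟩ := clr w1
  refine ⟨p, Polynomial.C (b2*b3*b4*b5) * T, Polynomial.C (b1*b3*b4*b5) * U, Polynomial.C (b1*b2*b4*b5) * W,
    Polynomial.C (b1*b2*b3*b5) * U', Polynomial.C (b1*b2*b3*b4) * W', b1*b2*b3*b4*b5, N, ?_, ?_, ?_, ?_, ?_⟩
  · simp [*]
  · rintro rfl
    have h1 : m 0 = 0 := map_zero _
    rw [h1] at hp
    exact (mul_ne_zero hub.ne_zero hp00) hp.symm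
  all_goals
    apply hminj
    change m _ = m _
    have hC : ∀ b, m (Polynomial.C b) = Polynomial.C (algebraMap R k b) := fun b => by simp [m]
    simp only [map_mul, map_add, map_pow, hC, hT, hU, hW, hU', hW']
  · rw [ht0]; ring
  · linear_combination (Polynomial.C ((algebraMap R k) b1) * Polynomial.C ((algebraMap R k) b2) * Polynomial.C ((algebraMap R k) b3) * Polynomial.C ((algebraMap R k) b4) * Polynomial.C ((algebraMap R k) b5)) * huw
  · linear_combination (Polynomial.C ((algebraMap R k) b1) * Polynomial.C ((algebraMap R k) b2) * Polynomial.C ((algebraMap R k) b3) * Polynomial.C ((algebraMap R k) b4) * Polynomial.C ((algebraMap R k) b5)) * huw'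

end Part1

section Part2
open MvPolynomial Filter Topology

/-! ### roots -/
/-- evaluation of a polynomial with polynomial coefficients -/
noncomputable def ev {n : ℕ} (p : Polynomial (MvPolynomial (Fin n) ℂ)) (a : Fin n → ℂ) (t : ℂ) : ℂ :=
  Polynomial.eval t (Polynomial.map (eval a) p)

theorem ev_sum {n : ℕ} (p : Polynomial (MvPolynomial (Fin n) ℂ)) (a : Fin n → ℂ) (t : ℂ) :
    ev p a t = ∑ i ∈ Finset.range (p.natDegree + 1), eval a (p.coeff i) * t ^ i := by
  unfold ev
  rw [Polynomial.eval_map, Polynomial.eval₂_eq_sum_range]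

theorem ev_analyticAt {n : ℕ} (p : Polynomial (MvPolynomial (Fin n) ℂ)) (w : (Fin n → ℂ) × ℂ) :
    AnalyticAt ℂ (fun w : (Fin n → ℂ) × ℂ => ev p w.1 w.2) w := by
  simp only [ev_sum]
  refine Finset.analyticAt_fun_sum _ fun i _ => ?_
  refine AnalyticAt.mul ?_ (analyticAt_snd.pow i)
  exact (eval_analyticAt (p.coeff i) w.1).comp_of_eq analyticAt_fst rfl

theorem implicit_root {n : ℕ} (p : Polynomial (MvPolynomial (Fin n) ℂ)) (a : Fin n → ℂ) (z : ℂ)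
    (hz : ev p a z = 0) (hd : Polynomial.eval z (Polynomial.derivative (Polynomial.map (eval a) p)) ≠ 0) :
    ∃ ρ : (Fin n → ℂ) → ℂ, AnalyticAt ℂ ρ a ∧ ρ a = z ∧ ∀ᶠ x in 𝓝 a, ev p x (ρ x) = 0 := by
  set f : (Fin n → ℂ) × ℂ → ℂ := fun w => ev p w.1 w.2 with hf
  have hc : ContDiffAt ℂ (⊤ : WithTop ℕ∞) f (a, z) := (ev_analyticAt p (a, z)).contDiffAt
  have hderiv : ∀ s : ℂ, (fderiv ℂ f (a, z) ∘L .inr ℂ (Fin n → ℂ) ℂ) s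
      = s * Polynomial.eval z (Polynomial.derivative (Polynomial.map (eval a) p)) := by
    intro s
    have h1 : HasFDerivAt f (fderiv ℂ f (a, z)) ((fun t : ℂ => (a, t)) z) :=
      (ev_analyticAt p (a, z)).differentiableAt.hasFDerivAt
    have h2 : HasFDerivAt (fun t : ℂ => (a, t)) (.inr ℂ (Fin n → ℂ) ℂ) z := hasFDerivAt_prodMk_right a z
    have h3 := (h1.comp z h2).hasDerivAt
    have h4 : HasDerivAt (f ∘ fun t : ℂ => (a, t)) _ z :=
      Polynomial.hasDerivAt (Polynomial.map (eval a) p) z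
    have := h3.unique h4
    rw [← this]
    have h5 : s = s • (1:ℂ) := by simp
    conv_lhs => rw [h5, map_smul]
    simp
  have hinv : (fderiv ℂ f (a, z) ∘L .inr ℂ (Fin n → ℂ) ℂ).IsInvertible := by
    refine ⟨ContinuousLinearEquiv.unitsEquivAut ℂ (Units.mk0 _ hd), ?_⟩
    ext
    simp [hderiv]
  refine ⟨hc.implicitFunction (by simp) hinv, ?_, ?_, ?_⟩
  · exact (hc.contDiffAt_implicitFunction (by simp) hinv).analyticAt
  · exact hc.implicitFunction_apply_self (by simp) hinv
  · have := hc.eventually_apply_implicitFunction (by simp) hinv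
    filter_upwards [this] with x hx
    simpa [hf, hz] using hx

/-- good polynomial over the set where `Q ≠ 0`. -/
structure GoodP {n : ℕ} (p : Polynomial (MvPolynomial (Fin n) ℂ)) (Q : MvPolynomial (Fin n) ℂ) : Prop where
  lc : p.leadingCoeff ∣ Q
  sep : ∀ a, eval a Q ≠ 0 → (Polynomial.map (eval a) p).Separable

namespace GoodP
variable {n : ℕ} {p : Polynomial (MvPolynomial (Fin n) ℂ)} {Q : MvPolynomial (Fin n) ℂ}

theorem lc_ne (h : GoodP p Q) {a : Fin n → ℂ} (ha : eval a Q ≠ 0) : eval a p.leadingCoeff ≠ 0 := by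
  intro h0
  obtain ⟨c, hc⟩ := h.lc
  rw [hc, map_mul, h0, zero_mul] at ha
  exact ha rfl

/-- roots of the fibre -/
noncomputable def rts (p : Polynomial (MvPolynomial (Fin n) ℂ)) (a : Fin n → ℂ) : Finset ℂ :=
  (Polynomial.map (eval a) p).roots.toFinset

theorem mem_rts (h : GoodP p Q) {a : Fin n → ℂ} (ha : eval a Q ≠ 0) {t : ℂ} :
    t ∈ rts p a ↔ ev p a t = 0 := by
  have := (h.sep a ha).ne_zero
  simp [rts, ev, this]

theorem card_rts (h : GoodP p Q) {a : Fin n → ℂ} (ha : eval a Q ≠ 0) :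
    (rts p a).card = p.natDegree := by
  unfold rts
  rw [Multiset.toFinset_card_of_nodup (Polynomial.nodup_roots (h.sep a ha)),
    IsAlgClosed.card_roots_eq_natDegree]
  exact Polynomial.natDegree_map_of_leadingCoeff_ne_zero _ (h.lc_ne ha)

theorem rootBall (h : GoodP p Q) {a : Fin n → ℂ} (ha : eval a Q ≠ 0) :
    ∃ (r₀ : ℝ) (ρ : ℂ → (Fin n → ℂ) → ℂ), 0 < r₀ ∧ (∀ x ∈ Metric.ball a r₀, eval x Q ≠ 0) ∧
      (∀ z ∈ rts p a, ρ z a = z ∧ ∀ x ∈ Metric.ball a r₀, AnalyticAt ℂ (ρ z) x) ∧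
      ∀ x ∈ Metric.ball a r₀, (∀ z ∈ rts p a, ∀ z' ∈ rts p a, ρ z x = ρ z' x → z = z') ∧
        (∀ z ∈ rts p a, ev p x (ρ z x) = 0) ∧ ∀ t, ev p x t = 0 → ∃ z ∈ rts p a, ρ z x = t := by
  have h1 : ∀ z : ℂ, ∃ ρ : (Fin n → ℂ) → ℂ, z ∈ rts p a →
      AnalyticAt ℂ ρ a ∧ ρ a = z ∧ ∀ᶠ x in 𝓝 a, ev p x (ρ x) = 0 := by
    intro z
    by_cases hz : z ∈ rts p a
    · have hz0 := (h.mem_rts ha).1 hz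
      have hd : Polynomial.eval z (Polynomial.derivative (Polynomial.map (eval a) p)) ≠ 0 := by
        have := (h.sep a ha).eval₂_derivative_ne_zero (RingHom.id ℂ) (x := z)
          (by simpa [Polynomial.eval₂_id, ev] using hz0)
        simpa [Polynomial.eval₂_id] using this
      obtain ⟨ρ, hρ⟩ := implicit_root p a z hz0 hd
      exact ⟨ρ, fun _ => hρ⟩
    · exact ⟨0, fun h => absurd h hz⟩
  choose ρ hρ using h1
  have e1 : ∀ᶠ x in 𝓝 a, eval x Q ≠ 0 := (eval_analyticAt Q a).continuousAt.eventually_ne ha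
  have e2 : ∀ᶠ x in 𝓝 a, ∀ z ∈ rts p a, AnalyticAt ℂ (ρ z) x := by
    rw [Finset.eventually_all]
    exact fun z hz => (hρ z hz).1.eventually_analyticAt
  have e3 : ∀ᶠ x in 𝓝 a, ∀ z ∈ rts p a, ev p x (ρ z x) = 0 := by
    rw [Finset.eventually_all]
    exact fun z hz => (hρ z hz).2.2
  have e4 : ∀ᶠ x in 𝓝 a, ∀ z ∈ rts p a, ∀ z' ∈ rts p a, ρ z x = ρ z' x → z = z' := by
    rw [Finset.eventually_all]
    intro z hz
    rw [Finset.eventually_all]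
    intro z' hz'
    by_cases hzz : z = z'
    · exact Eventually.of_forall fun _ _ => hzz
    · have : ∀ᶠ x in 𝓝 a, ρ z x - ρ z' x ≠ 0 := by
        refine ((hρ z hz).1.continuousAt.sub (hρ z' hz').1.continuousAt).eventually_ne ?_
        rw [Pi.sub_apply, (hρ z hz).2.1, (hρ z' hz').2.1]
        exact sub_ne_zero.2 hzz
      filter_upwards [this] with x hx hx'
      exact absurd (sub_eq_zero.2 hx') hx
  obtain ⟨r, hr, hball⟩ := Metric.eventually_nhds_iff_ball.1 (e1.and (e2.and (e3.and e4)))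
  refine ⟨r, ρ, hr, fun x hx => (hball x hx).1, fun z hz => ⟨(hρ z hz).2.1, fun x hx => (hball x hx).2.1 z hz⟩,
    fun x hx => ⟨(hball x hx).2.2.2, (hball x hx).2.2.1, ?_⟩⟩
  intro t ht
  have hsub : (rts p a).image (fun z => ρ z x) ⊆ rts p x := by
    intro y hy
    obtain ⟨z, hz, rfl⟩ := Finset.mem_image.1 hy
    exact (h.mem_rts (hball x hx).1).2 ((hball x hx).2.2.1 z hz)
  have heq := Finset.eq_of_subset_of_card_le hsub (by
    rw [Finset.card_image_of_injOn (fun z hz z' hz' => (hball x hx).2.2.2 z hz z' hz'),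
      h.card_rts ha, h.card_rts (hball x hx).1])
  have := (h.mem_rts (hball x hx).1).2 ht
  rw [← heq] at this
  exact Finset.mem_image.1 this

/-- bound for the roots -/
theorem root_bound (h : GoodP p Q) : ∃ (C : ℝ) (M : ℕ), 0 ≤ C ∧ ∀ a, eval a Q ≠ 0 → ∀ t, ev p a t = 0 →
    ‖eval a Q * t‖ ≤ C * (1 + ‖a‖) ^ M := by
  obtain ⟨c, hc⟩ := h.lc
  have hb : ∀ i, ∃ (C : ℝ) (M : ℕ), 0 ≤ C ∧ ∀ w : Fin n → ℂ, ‖eval w (c * p.coeff i)‖ ≤ C * (1 + ‖w‖) ^ M :=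
    fun i => poly_growth _
  choose K M hK hKM using hb
  obtain ⟨K', M', hK', hKM'⟩ := poly_growth Q
  set d := p.natDegree with hd
  refine ⟨K' + ∑ i ∈ Finset.range d, K i, M' + ∑ i ∈ Finset.range d, M i,
    add_nonneg hK' (Finset.sum_nonneg fun i _ => hK i), ?_⟩
  intro a ha t ht
  have h1 : (1:ℝ) ≤ 1 + ‖a‖ := by linarith [norm_nonneg a]
  have hQle : ‖eval a Q‖ ≤ K' * (1 + ‖a‖) ^ (M' + ∑ i ∈ Finset.range d, M i) :=
    (hKM' a).trans (by gcongr; omega)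
  have hsumle : ∑ i ∈ Finset.range d, ‖eval a (c * p.coeff i)‖ ≤
      (∑ i ∈ Finset.range d, K i) * (1 + ‖a‖) ^ (M' + ∑ i ∈ Finset.range d, M i) := by
    rw [Finset.sum_mul]
    refine Finset.sum_le_sum fun i hi => (hKM i a).trans ?_
    gcongr
    · exact hK i
    · have := Finset.single_le_sum (f := M) (fun _ _ => Nat.zero_le _) hi
      omega
  have hs0 : 0 ≤ (∑ i ∈ Finset.range d, K i) * (1 + ‖a‖) ^ (M' + ∑ i ∈ Finset.range d, M i) :=
    (Finset.sum_nonneg fun i _ => norm_nonneg _).trans hsumle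
  rw [add_mul]
  rcases le_total ‖t‖ 1 with ht1 | ht1
  · calc ‖eval a Q * t‖ = ‖eval a Q‖ * ‖t‖ := norm_mul _ _
      _ ≤ ‖eval a Q‖ * 1 := by gcongr
      _ ≤ _ := by linarith
  · have ht0 : 0 < ‖t‖ := by linarith
    rw [ev_sum, Finset.sum_range_succ] at ht
    have hlead : eval a Q * t ^ d = - ∑ i ∈ Finset.range d, eval a (c * p.coeff i) * t ^ i := by
      have : eval a Q = eval a c * eval a (p.coeff d) := by
        rw [hc, map_mul, mul_comm]; rfl
      rw [this, eq_neg_iff_add_eq_zero]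
      calc _ = eval a c * (∑ i ∈ Finset.range d, eval a (p.coeff i) * t ^ i + eval a (p.coeff d) * t ^ d) := by
            rw [mul_add, Finset.mul_sum, add_comm]
            congr 1
            · refine Finset.sum_congr rfl fun i _ => by rw [map_mul]; ring
            · ring
        _ = 0 := by rw [ht, mul_zero]
    rcases Nat.eq_zero_or_pos d with hd0 | hdpos
    · rw [hd0] at hlead
      simp at hlead
      exact absurd hlead ha
    · obtain ⟨e, he⟩ : ∃ e, d = e + 1 := ⟨d - 1, by omega⟩
      have hn : ‖eval a Q * t‖ * ‖t‖ ^ e ≤ (∑ i ∈ Finset.range d, ‖eval a (c * p.coeff i)‖) * ‖t‖ ^ e := by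
        calc ‖eval a Q * t‖ * ‖t‖ ^ e = ‖eval a Q * t ^ d‖ := by
              rw [he, norm_mul, norm_mul, norm_pow]; ring
          _ ≤ ∑ i ∈ Finset.range d, ‖eval a (c * p.coeff i) * t ^ i‖ := by
              rw [hlead, norm_neg]; exact norm_sum_le _ _
          _ ≤ _ := by
              rw [Finset.sum_mul]
              refine Finset.sum_le_sum fun i hi => ?_
              rw [norm_mul, norm_pow]
              gcongr
              · have := Finset.mem_range.1 hi; omega
      have := le_of_mul_le_mul_right hn (by positivity)
      have h0 : 0 ≤ K' * (1 + ‖a‖) ^ (M' + ∑ i ∈ Finset.range d, M i) := by positivity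
      linarith

end GoodP

theorem diff_prod {E κ : Type*} [NormedAddCommGroup E] [NormedSpace ℂ E] {s : Set E} {x : E}
    {F : κ → E → ℂ} {S : Finset κ} (hF : ∀ z ∈ S, DifferentiableWithinAt ℂ (F z) s x) :
    DifferentiableWithinAt ℂ (fun y => ∏ z ∈ S, F z y) s x := by
  classical
  induction S using Finset.induction_on with
  | empty => simpa using differentiableWithinAt_const (1 : ℂ)
  | insert z T hz ih =>
    simp only [Finset.prod_insert hz]
    exact (hF z (Finset.mem_insert_self _ _)).mul (ih fun z hz => hF z (Finset.mem_insert_of_mem hz))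

theorem ident_prod {ι κ : Type*} [Fintype ι] {s : Set (ι → ℂ)} (hs : Convex ℝ s) (ho : IsOpen s)
    (hne : s.Nonempty) (F : κ → (ι → ℂ) → ℂ) (S : Finset κ) (hF : ∀ z ∈ S, DifferentiableOn ℂ (F z) s)
    (h : ∀ x ∈ s, ∃ z ∈ S, F z x = 0) : ∃ z ∈ S, ∀ x ∈ s, F z x = 0 := by
  classical
  by_contra hcon
  push Not at hcon
  have : ∀ T ⊆ S, ∃ y ∈ s, ∏ z ∈ T, F z y ≠ 0 := by
    intro T
    induction T using Finset.induction_on with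
    | empty => intro _; obtain ⟨y, hy⟩ := hne; exact ⟨y, hy, by simp⟩
    | insert z T hz ih =>
      intro hT
      have hT' : T ⊆ S := (Finset.subset_insert _ _).trans hT
      obtain ⟨y, hy, hy'⟩ := ident_mul hs ho (hF z (hT (Finset.mem_insert_self _ _)))
        (g := fun y => ∏ z ∈ T, F z y) (fun x hx => diff_prod fun z hz => hF z (hT' hz) x hx) (hcon z (hT (Finset.mem_insert_self _ _))) (ih hT')
      exact ⟨y, hy, by rwa [Finset.prod_insert hz]⟩
  obtain ⟨y, hy, hy'⟩ := this S subset_rfl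
  obtain ⟨z, hz, hz'⟩ := h y hy
  exact hy' (Finset.prod_eq_zero hz hz')

end Part2

section Part3
open MvPolynomial Filter Topology

/-- quotient map -/
noncomputable def quo {n : ℕ} (g h : Fin n → (Fin n → ℂ) → ℂ) (u : Fin n → ℂ) : Fin n → ℂ :=
  fun j => g j u / h j u

/-- The data for the core argument. -/
structure Core (n : ℕ) where
  g : Fin n → (Fin n → ℂ) → ℂ
  h : Fin n → (Fin n → ℂ) → ℂ
  gt : (Fin n → ℂ) → ℂ
  ht : (Fin n → ℂ) → ℂ
  H : (Fin n → ℂ) → ℂ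
  k : Fin n
  b : Fin n → ℂ
  ag : ∀ j u, AnalyticAt ℂ (g j) u
  ah : ∀ j u, AnalyticAt ℂ (h j) u
  agt : ∀ u, AnalyticAt ℂ gt u
  aht : ∀ u, AnalyticAt ℂ ht u
  dH : Differentiable ℂ H
  Hne : ∃ u, H u ≠ 0
  hh : ∀ u, H u ≠ 0 → ∀ j, h j u ≠ 0
  hht : ∀ u, H u ≠ 0 → ht u ≠ 0
  hhs : ∀ u, H u ≠ 0 → h k (u + b) ≠ 0
  pt : Polynomial (MvPolynomial (Fin n) ℂ)
  ps : Polynomial (MvPolynomial (Fin n) ℂ)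
  Q : MvPolynomial (Fin n) ℂ
  gpt : GoodP pt Q
  gps : GoodP ps Q
  Qne : ∀ u, H u ≠ 0 → eval (quo g h u) Q ≠ 0
  rt : ∀ u, H u ≠ 0 → ev pt (quo g h u) (gt u / ht u) = 0
  rs : ∀ u, H u ≠ 0 → ev ps (quo g h u) (g k (u + b) / h k (u + b)) = 0
  Mf : (Fin n → ℂ) × ℂ → ((Fin n → ℂ) →L[ℂ] (Fin n → ℂ))
  aMf : ∀ a t, eval a Q ≠ 0 → ev pt a t = 0 → AnalyticAt ℂ Mf (a, t)
  Ml : ∀ u, H u ≠ 0 → Mf (quo g h u, gt u / ht u) ∘L fderiv ℂ (quo g h) u = .id ℂ _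
  Mr : ∀ u, H u ≠ 0 → fderiv ℂ (quo g h) u ∘L Mf (quo g h u, gt u / ht u) = .id ℂ _

namespace Core
variable {n : ℕ} (c : Core n)

/-- the map -/
noncomputable def Φ : (Fin n → ℂ) → (Fin n → ℂ) := quo c.g c.h
/-- primitive element -/
noncomputable def θ (u : Fin n → ℂ) : ℂ := c.gt u / c.ht u
/-- the translate -/
noncomputable def ψ (u : Fin n → ℂ) : ℂ := c.g c.k (u + c.b) / c.h c.k (u + c.b)

theorem aΦ {u} (hu : c.H u ≠ 0) : AnalyticAt ℂ c.Φ u :=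
  AnalyticAt.pi fun j => (c.ag j u).div (c.ah j u) (c.hh u hu j)

theorem aθ {u} (hu : c.H u ≠ 0) : AnalyticAt ℂ c.θ u :=
  (c.agt u).div (c.aht u) (c.hht u hu)

theorem tr_an {f : (Fin n → ℂ) → ℂ} (hf : ∀ u, AnalyticAt ℂ f u) (b u : Fin n → ℂ) :
    AnalyticAt ℂ (fun u => f (u + b)) u :=
  (hf (u + b)).comp_of_eq (analyticAt_id.add analyticAt_const) rfl

theorem aψ {u} (hu : c.H u ≠ 0) : AnalyticAt ℂ c.ψ u :=
  (tr_an (c.ag c.k) c.b u).div (tr_an (c.ah c.k) c.b u) (c.hhs u hu)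

/-- local sections -/
structure SecOn (s : Set (Fin n → ℂ)) (σ : (Fin n → ℂ) → (Fin n → ℂ)) (τ η : (Fin n → ℂ) → ℂ) : Prop where
  cvx : Convex ℝ s
  opn : IsOpen s
  dσ : DifferentiableOn ℂ σ s
  dτ : DifferentiableOn ℂ τ s
  dη : DifferentiableOn ℂ η s
  ne : ∃ a ∈ s, c.H (σ a) ≠ 0
  eq : ∀ a ∈ s, c.H (σ a) ≠ 0 → c.Φ (σ a) = a ∧ c.θ (σ a) = τ a ∧ c.ψ (σ a) = η a

variable {c}
namespace SecOn
variable {s s' : Set (Fin n → ℂ)} {σ σ' : (Fin n → ℂ) → (Fin n → ℂ)} {τ η τ' η' : (Fin n → ℂ) → ℂ}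

theorem dHσ (S : c.SecOn s σ τ η) : DifferentiableOn ℂ (fun a => c.H (σ a)) s :=
  c.dH.comp_differentiableOn S.dσ

theorem dense (S : c.SecOn s σ τ η) {a : Fin n → ℂ} (ha : a ∈ s) : ∃ᶠ x in 𝓝 a, c.H (σ x) ≠ 0 ∧ x ∈ s :=
  (ident_dense S.cvx S.opn S.dHσ S.ne ha).and_eventually (S.opn.mem_nhds ha)

theorem restrict (S : c.SecOn s σ τ η) (hs' : Convex ℝ s') (ho : IsOpen s') (hsub : s' ⊆ s) (hne : s'.Nonempty) :
    c.SecOn s' σ τ η where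
  cvx := hs'
  opn := ho
  dσ := S.dσ.mono hsub
  dτ := S.dτ.mono hsub
  dη := S.dη.mono hsub
  ne := by
    obtain ⟨a, ha⟩ := hne
    obtain ⟨x, hx, hx'⟩ := ((S.dense (hsub ha)).and_eventually (ho.mem_nhds ha)).exists
    exact ⟨x, hx', hx.1⟩
  eq := fun a ha => S.eq a (hsub ha)

theorem root_aux (S : c.SecOn s σ τ η) (p : Polynomial (MvPolynomial (Fin n) ℂ)) {f : (Fin n → ℂ) → ℂ}
    (hf : DifferentiableOn ℂ f s) (h : ∀ a ∈ s, c.H (σ a) ≠ 0 → ev p a (f a) = 0) {a : Fin n → ℂ} (ha : a ∈ s) :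
    ev p a (f a) = 0 := by
  have hc : ContinuousAt (fun x => ev p x (f x)) a := by
    have h1 : ContinuousAt (fun x => (x, f x)) a :=
      continuousAt_id.prodMk (hf.continuousOn.continuousAt (S.opn.mem_nhds ha))
    exact ContinuousAt.comp (f := fun x => (x, f x)) (g := fun w : (Fin n → ℂ) × ℂ => ev p w.1 w.2)
      (ev_analyticAt p (a, f a)).continuousAt h1
  exact eq_of_dense (f := fun x => ev p x (f x)) hc (g := fun _ => 0) continuousAt_const ((S.dense ha).mono fun x hx => h x hx.2 hx.1)

theorem root_t (S : c.SecOn s σ τ η) {a : Fin n → ℂ} (ha : a ∈ s) : ev c.pt a (τ a) = 0 := by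
  refine S.root_aux c.pt S.dτ (fun x hx hH => ?_) ha
  have h1 := S.eq x hx hH
  have := c.rt _ hH
  change ev c.pt (c.Φ (σ x)) (c.θ (σ x)) = 0 at this
  rwa [h1.1, h1.2.1] at this

theorem root_s (S : c.SecOn s σ τ η) {a : Fin n → ℂ} (ha : a ∈ s) : ev c.ps a (η a) = 0 := by
  refine S.root_aux c.ps S.dη (fun x hx hH => ?_) ha
  have h1 := S.eq x hx hH
  have := c.rs _ hH
  change ev c.ps (c.Φ (σ x)) (c.ψ (σ x)) = 0 at this
  rwa [h1.1, h1.2.2] at this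

theorem ev_ne (S : c.SecOn s σ τ η) {a : Fin n → ℂ} (ha : a ∈ s) (hH : c.H (σ a) ≠ 0) :
    ∀ᶠ x in 𝓝 a, x ∈ s ∧ c.H (σ x) ≠ 0 :=
  Filter.Eventually.and (S.opn.mem_nhds ha)
    ((S.dHσ.continuousOn.continuousAt (S.opn.mem_nhds ha)).eventually_ne hH)

theorem deriv (S : c.SecOn s σ τ η) {a : Fin n → ℂ} (ha : a ∈ s) (hH : c.H (σ a) ≠ 0) :
    HasFDerivAt σ (c.Mf (a, τ a)) a := by
  have h1 : HasFDerivAt σ (fderiv ℂ σ a) a := (S.dσ.differentiableAt (S.opn.mem_nhds ha)).hasFDerivAt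
  have h2 : HasFDerivAt c.Φ (fderiv ℂ c.Φ (σ a)) (σ a) := (c.aΦ hH).differentiableAt.hasFDerivAt
  have h3 := h2.comp a h1
  have h4 : HasFDerivAt (c.Φ ∘ σ) (.id ℂ _) a :=
    (hasFDerivAt_id a).congr_of_eventuallyEq (by
      filter_upwards [S.ev_ne ha hH] with x hx
      exact (S.eq x hx.1 hx.2).1)
  have h5 := h3.unique h4
  have h6 := c.Ml _ hH
  change c.Mf (c.Φ (σ a), c.θ (σ a)) ∘L fderiv ℂ c.Φ (σ a) = _ at h6
  rw [(S.eq a ha hH).1, (S.eq a ha hH).2.1] at h6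
  have h7 : fderiv ℂ σ a = c.Mf (a, τ a) := by
    calc fderiv ℂ σ a = (c.Mf (a, τ a) ∘L fderiv ℂ c.Φ (σ a)) ∘L fderiv ℂ σ a := by rw [h6]; rfl
      _ = c.Mf (a, τ a) ∘L (fderiv ℂ c.Φ (σ a) ∘L fderiv ℂ σ a) := rfl
      _ = _ := by rw [h5]; rfl
  rwa [h7] at h1

end SecOn

theorem exists_sec {u : Fin n → ℂ} (hu : c.H u ≠ 0) : ∃ s σ τ η, c.SecOn s σ τ η ∧ c.Φ u ∈ s ∧
    τ (c.Φ u) = c.θ u ∧ η (c.Φ u) = c.ψ u := by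
  have hl := c.Ml u hu
  have hr := c.Mr u hu
  let e : (Fin n → ℂ) ≃L[ℂ] (Fin n → ℂ) := ContinuousLinearEquiv.equivOfInverse
    (fderiv ℂ c.Φ u) (c.Mf (c.Φ u, c.θ u)) (fun x => DFunLike.congr_fun hl x) (fun x => DFunLike.congr_fun hr x)
  have hcd : ContDiffAt ℂ (⊤ : WithTop ℕ∞) c.Φ u := (c.aΦ hu).contDiffAt
  have hfd : HasFDerivAt c.Φ (e : (Fin n → ℂ) →L[ℂ] (Fin n → ℂ)) u := (c.aΦ hu).differentiableAt.hasFDerivAt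
  have hsd : HasStrictFDerivAt c.Φ (e : (Fin n → ℂ) →L[ℂ] (Fin n → ℂ)) u :=
    hcd.hasStrictFDerivAt' hfd (by simp)
  set σ := hcd.localInverse hfd (by simp) with hσ
  have hσa : AnalyticAt ℂ σ (c.Φ u) := (hcd.to_localInverse hfd (by simp)).analyticAt
  have hσu : σ (c.Φ u) = u := hcd.localInverse_apply_image hfd (by simp)
  have hri : ∀ᶠ x in 𝓝 (c.Φ u), c.Φ (σ x) = x := hsd.eventually_right_inverse
  have hH : ∀ᶠ x in 𝓝 (c.Φ u), c.H (σ x) ≠ 0 := by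
    have : ContinuousAt (fun x => c.H (σ x)) (c.Φ u) :=
      c.dH.continuous.continuousAt.comp hσa.continuousAt
    exact this.eventually_ne (by rwa [hσu])
  obtain ⟨r, hr, hball⟩ := Metric.eventually_nhds_iff_ball.1 (hσa.eventually_analyticAt.and (hri.and hH))
  refine ⟨Metric.ball (c.Φ u) r, σ, fun x => c.θ (σ x), fun x => c.ψ (σ x), ?_, Metric.mem_ball_self hr,
    by simp [hσu], by simp [hσu]⟩
  refine ⟨convex_ball _ _, Metric.isOpen_ball, ?_, ?_, ?_, ?_, ?_⟩
  · exact fun x hx => (hball x hx).1.differentiableAt.differentiableWithinAt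
  · exact fun x hx => ((c.aθ (hball x hx).2.2).differentiableAt.comp x (hball x hx).1.differentiableAt).differentiableWithinAt
  · exact fun x hx => ((c.aψ (hball x hx).2.2).differentiableAt.comp x (hball x hx).1.differentiableAt).differentiableWithinAt
  · exact ⟨_, Metric.mem_ball_self hr, (hball _ (Metric.mem_ball_self hr)).2.2⟩
  · exact fun x hx _ => ⟨(hball x hx).2.1, rfl, rfl⟩

theorem const_diff {f f' : (Fin n → ℂ) → (Fin n → ℂ)} {ω : (Fin n → ℂ) → ((Fin n → ℂ) →L[ℂ] (Fin n → ℂ))}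
    {a : Fin n → ℂ} (h : ∀ᶠ x in 𝓝 a, HasFDerivAt f (ω x) x ∧ HasFDerivAt f' (ω x) x) :
    ∀ᶠ x in 𝓝 a, f x = f' x + (f a - f' a) := by
  obtain ⟨r, hr, hball⟩ := Metric.eventually_nhds_iff_ball.1 h
  filter_upwards [Metric.ball_mem_nhds a hr] with x hx
  have hd : ∀ y ∈ Metric.ball a r, HasFDerivAt (fun y => f y - f' y) (0 : (Fin n → ℂ) →L[ℂ] (Fin n → ℂ)) y := fun y hy => by
    simpa using (hball y hy).1.sub (hball y hy).2
  have : f x - f' x = f a - f' a := IsOpen.is_const_of_fderiv_eq_zero (𝕜 := ℂ) (f := fun y => f y - f' y) Metric.isOpen_ball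
    (convex_ball a r).isPreconnected (fun y hy => (hd y hy).differentiableAt.differentiableWithinAt)
    (fun y hy => (hd y hy).fderiv) hx (Metric.mem_ball_self hr)
  rw [← this]; abel

theorem uniq {s s' : Set (Fin n → ℂ)} {σ σ' : (Fin n → ℂ) → (Fin n → ℂ)} {τ η τ' η' : (Fin n → ℂ) → ℂ}
    (S : c.SecOn s σ τ η) (S' : c.SecOn s' σ' τ' η') {a : Fin n → ℂ} (ha : a ∈ s) (ha' : a ∈ s')
    (hQ : eval a c.Q ≠ 0) (heq : τ a = τ' a) : η a = η' a := by
  obtain ⟨r, ρ, hr, hQb, hρ, hroot⟩ := c.gpt.rootBall hQ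
  set s1 := s ∩ s' ∩ Metric.ball a r with hs1
  have hcv : Convex ℝ s1 := (S.cvx.inter S'.cvx).inter (convex_ball _ _)
  have hop : IsOpen s1 := (S.opn.inter S'.opn).inter Metric.isOpen_ball
  have ha1 : a ∈ s1 := ⟨⟨ha, ha'⟩, Metric.mem_ball_self hr⟩
  replace S := S.restrict hcv hop (fun x hx => hx.1.1) ⟨a, ha1⟩
  replace S' := S'.restrict hcv hop (fun x hx => hx.1.2) ⟨a, ha1⟩
  have hb1 : ∀ x ∈ s1, x ∈ Metric.ball a r := fun x hx => hx.2
  clear_value s1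
  have key : ∀ {σ τ η}, c.SecOn s1 σ τ η → ∃ z ∈ GoodP.rts c.pt a, ∀ x ∈ s1, τ x = ρ z x := by
    intro σ τ η S
    obtain ⟨z, hz, h⟩ := ident_prod S.cvx S.opn ⟨a, ha1⟩ (fun z x => ρ z x - τ x) (GoodP.rts c.pt a)
      (fun z hz x hx => ((hρ z hz).2 x (hb1 x hx)).differentiableAt.differentiableWithinAt.sub (S.dτ x hx))
      (fun x hx => by
        obtain ⟨z, hz, h⟩ := (hroot x (hb1 x hx)).2.2 _ (S.root_t hx)
        exact ⟨z, hz, sub_eq_zero.2 h⟩)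
    exact ⟨z, hz, fun x hx => (sub_eq_zero.1 (h x hx)).symm⟩
  obtain ⟨z, hz, hτ⟩ := key S
  obtain ⟨z', hz', hτ'⟩ := key S'
  have hzz : z = z' := by
    rw [← (hρ z hz).1, ← (hρ z' hz').1, ← hτ a ha1, ← hτ' a ha1, heq]
  subst hzz
  have hττ : ∀ x ∈ s1, τ x = τ' x := fun x hx => (hτ x hx).trans (hτ' x hx).symm
  obtain ⟨a', ha'1, hHH⟩ := ident_mul hcv hop S.dHσ S'.dHσ S.ne S'.ne
  have hH := left_ne_zero_of_mul hHH
  have hH' := right_ne_zero_of_mul hHH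
  have hshift : ∀ᶠ x in 𝓝 a', σ' x = σ x + (σ' a' - σ a') := by
    apply const_diff (ω := fun x => c.Mf (x, τ x))
    filter_upwards [S.ev_ne ha'1 hH, S'.ev_ne ha'1 hH'] with x hx hx'
    refine ⟨?_, S.deriv hx.1 hx.2⟩
    rw [hττ x hx.1]
    exact S'.deriv hx'.1 hx'.2
  set γ := σ' a' - σ a' with hγ
  have hMfc : ContinuousAt (fun x => c.Mf (x, τ x)) a' := by
    have h1 : ContinuousAt (fun x => (x, τ x)) a' :=
      continuousAt_id.prodMk (S.dτ.continuousOn.continuousAt (hop.mem_nhds ha'1))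
    exact ContinuousAt.comp (f := fun x => (x, τ x)) (g := c.Mf)
      (c.aMf a' (τ a') (hQb a' (hb1 _ ha'1)) (S.root_t ha'1)).continuousAt h1
  have hstrict : HasStrictFDerivAt σ (c.Mf (a', τ a')) a' :=
    hasStrictFDerivAt_of_hasFDerivAt_of_continuousAt (f' := fun x => c.Mf (x, τ x))
      (by filter_upwards [S.ev_ne ha'1 hH] with x hx using S.deriv hx.1 hx.2) hMfc
  have hl := c.Ml _ hH
  change c.Mf (c.Φ (σ a'), c.θ (σ a')) ∘L _ = _ at hl
  rw [(S.eq a' ha'1 hH).1, (S.eq a' ha'1 hH).2.1] at hl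
  have hmap : map σ (𝓝 a') = 𝓝 (σ a') := by
    apply hstrict.map_nhds_eq_of_surj
    rw [LinearMap.range_eq_top]
    intro y
    exact ⟨_, DFunLike.congr_fun hl y⟩
  -- periodicity
  have hper : ∀ j w, c.g j (w + γ) * c.h j w - c.g j w * c.h j (w + γ) = 0 := by
    intro j w
    refine ident (s := Set.univ) convex_univ isOpen_univ (f := fun w => c.g j (w + γ) * c.h j w - c.g j w * c.h j (w + γ)) ?_
      (Set.mem_univ (σ a')) ?_ w (Set.mem_univ w)
    · intro w _
      exact (((tr_an (c.ag j) γ w).mul (c.ah j w)).sub ((c.ag j w).mul (tr_an (c.ah j) γ w))).differentiableAt.differentiableWithinAt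
    · rw [← hmap, eventually_map]
      filter_upwards [S.ev_ne ha'1 hH, S'.ev_ne ha'1 hH', hshift] with x hx hx' hsh
      rw [← hsh]
      have e1 := congrFun (S.eq x hx.1 hx.2).1 j
      have e2 := congrFun (S'.eq x hx'.1 hx'.2).1 j
      have n1 := c.hh _ hx.2 j
      have n2 := c.hh _ hx'.2 j
      change c.g j (σ x) / c.h j (σ x) = x j at e1
      change c.g j (σ' x) / c.h j (σ' x) = x j at e2
      rw [div_eq_iff n1] at e1
      rw [div_eq_iff n2] at e2
      rw [e1, e2]; ring
  have hηη : ∀ᶠ x in 𝓝 a', η x - η' x = 0 := by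
    filter_upwards [S.ev_ne ha'1 hH, S'.ev_ne ha'1 hH', hshift] with x hx hx' hsh
    rw [← (S.eq x hx.1 hx.2).2.2, ← (S'.eq x hx'.1 hx'.2).2.2]
    have n1 := c.hhs _ hx.2
    have n2 := c.hhs _ hx'.2
    have := hper c.k (σ x + c.b)
    rw [show σ x + c.b + γ = σ' x + c.b by rw [hsh]; abel] at this
    unfold Core.ψ
    rw [div_sub_div _ _ n1 n2, div_eq_zero_iff]
    left
    linear_combination -this
  exact sub_eq_zero.1 (ident hcv hop (f := fun x => η x - η' x) (S.dη.sub S'.dη) ha'1 hηη a ha1)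

theorem ext_sec {a : Fin n → ℂ} (hQ : eval a c.Q ≠ 0) : ∃ r : ℝ, 0 < r ∧ (∀ x ∈ Metric.ball a r, eval x c.Q ≠ 0) ∧
    ∀ s σ τ η, c.SecOn s σ τ η → ∀ a1 ∈ s, a1 ∈ Metric.ball a r →
      ∃ σ' τ' η', c.SecOn (Metric.ball a r) σ' τ' η' ∧ τ' a1 = τ a1 ∧ η' a1 = η a1 := by
  obtain ⟨r1, ρ, hr1, hQb1, hρ1, hroot1⟩ := c.gpt.rootBall hQ
  obtain ⟨r2, ρ', hr2, hQb2, hρ2, hroot2⟩ := c.gps.rootBall hQ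
  set r := min r1 r2 with hrdef
  have hr : 0 < r := lt_min hr1 hr2
  have hB1 : Metric.ball a r ⊆ Metric.ball a r1 := Metric.ball_subset_ball (min_le_left _ _)
  have hB2 : Metric.ball a r ⊆ Metric.ball a r2 := Metric.ball_subset_ball (min_le_right _ _)
  refine ⟨r, hr, fun x hx => hQb1 x (hB1 hx), ?_⟩
  intro s σ τ η S a1 ha1s ha1
  set B := Metric.ball a r with hB
  have hBc : Convex ℝ B := convex_ball _ _
  have hBo : IsOpen B := Metric.isOpen_ball
  clear_value B
  set s1 := s ∩ B with hs1
  have ha11 : a1 ∈ s1 := ⟨ha1s, ha1⟩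
  replace S := S.restrict (S.cvx.inter hBc) (S.opn.inter hBo) (fun x hx => hx.1) ⟨a1, ha11⟩
  obtain ⟨z, hz, hτ⟩ := ident_prod S.cvx S.opn ⟨a1, ha11⟩ (fun z x => ρ z x - τ x) (GoodP.rts c.pt a)
      (fun z hz x hx => ((hρ1 z hz).2 x (hB1 hx.2)).differentiableAt.differentiableWithinAt.sub (S.dτ x hx))
      (fun x hx => by
        obtain ⟨z, hz, h⟩ := (hroot1 x (hB1 hx.2)).2.2 _ (S.root_t hx)
        exact ⟨z, hz, sub_eq_zero.2 h⟩)
  obtain ⟨z', hz', hη⟩ := ident_prod S.cvx S.opn ⟨a1, ha11⟩ (fun z x => ρ' z x - η x) (GoodP.rts c.ps a)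
      (fun z hz x hx => ((hρ2 z hz).2 x (hB2 hx.2)).differentiableAt.differentiableWithinAt.sub (S.dη x hx))
      (fun x hx => by
        obtain ⟨z, hz, h⟩ := (hroot2 x (hB2 hx.2)).2.2 _ (S.root_s hx)
        exact ⟨z, hz, sub_eq_zero.2 h⟩)
  replace hτ : ∀ x ∈ s1, ρ z x = τ x := fun x hx => sub_eq_zero.1 (hτ x hx)
  replace hη : ∀ x ∈ s1, ρ' z' x = η x := fun x hx => sub_eq_zero.1 (hη x hx)
  set ω : (Fin n → ℂ) → ((Fin n → ℂ) →L[ℂ] (Fin n → ℂ)) := fun x => c.Mf (x, ρ z x) with hω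
  have hωa : ∀ x ∈ B, AnalyticAt ℂ ω x := fun x hx =>
    (c.aMf x (ρ z x) (hQb1 x (hB1 hx)) ((hroot1 x (hB1 hx)).2.1 z hz)).comp_of_eq
      (analyticAt_id.prod ((hρ1 z hz).2 x (hB1 hx))) rfl
  obtain ⟨a', ha', hH⟩ := S.ne
  have hσω : ∀ᶠ x in 𝓝 a', HasFDerivAt σ (ω x) x := by
    filter_upwards [S.ev_ne ha' hH] with x hx
    rw [hω]
    simp only
    rw [hτ x hx.1]
    exact S.deriv hx.1 hx.2
  have hsymm : ∀ x ∈ B, ∀ v w, fderiv ℂ ω x v w = fderiv ℂ ω x w v := by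
    intro x hx v w
    ext i
    refine sub_eq_zero.1 (ident hBc hBo (f := fun x => fderiv ℂ ω x v w i - fderiv ℂ ω x w v i) ?_ ha'.2 ?_ x hx)
    · intro y hy
      have hd : DifferentiableAt ℂ (fderiv ℂ ω) y := (hωa y hy).fderiv.differentiableAt
      have h1 : ∀ v w, DifferentiableAt ℂ (fun y => fderiv ℂ ω y v w i) y := by
        intro v w
        have h2 : DifferentiableAt ℂ (fun y => fderiv ℂ ω y v w) y :=
          (hd.clm_apply (differentiableAt_const v)).clm_apply (differentiableAt_const w)
        exact differentiableAt_pi.1 h2 i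
      exact ((h1 v w).sub (h1 w v)).differentiableWithinAt
    · filter_upwards [hσω.eventually_nhds, hBo.mem_nhds ha'.2] with y hy hyB
      rw [second_derivative_symmetric_of_eventually hy (hωa y hyB).differentiableAt.hasFDerivAt v w, sub_self]
  obtain ⟨f, hf⟩ := hBc.exists_forall_hasFDerivAt_of_fderiv_symmetric (𝕜 := ℂ) (ω := ω) hBo
    (fun x hx => ((hωa x hx).differentiableAt.restrictScalars ℝ).differentiableWithinAt)
    (fun x hx v w => by
      rw [(hωa x hx).differentiableAt.fderiv_restrictScalars ℝ]
      exact hsymm x hx v w)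
  have hfσ : ∀ᶠ x in 𝓝 a', σ x = f x + (σ a' - f a') := by
    apply const_diff (ω := ω)
    filter_upwards [hσω, hBo.mem_nhds ha'.2] with x hx hxB using ⟨hx, hf x hxB⟩
  set S' : (Fin n → ℂ) → (Fin n → ℂ) := fun x => f x + (σ a' - f a') with hS'
  have hS'd : DifferentiableOn ℂ S' B := fun x hx =>
    ((hf x hx).differentiableAt.add (differentiableAt_const _)).differentiableWithinAt
  have hρd : DifferentiableOn ℂ (ρ z) B := fun x hx => ((hρ1 z hz).2 x (hB1 hx)).differentiableAt.differentiableWithinAt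
  have hρd' : DifferentiableOn ℂ (ρ' z') B := fun x hx => ((hρ2 z' hz').2 x (hB2 hx)).differentiableAt.differentiableWithinAt
  have hS'a : S' a' = σ a' := by simp [hS']
  have key : ∀ (G K : (Fin n → ℂ) → ℂ) (y : (Fin n → ℂ) → ℂ), (∀ u, AnalyticAt ℂ G u) → (∀ u, AnalyticAt ℂ K u) →
      DifferentiableOn ℂ y B → (∀ x ∈ s1, c.H (σ x) ≠ 0 → G (σ x) = y x * K (σ x)) →
      ∀ x ∈ B, G (S' x) = y x * K (S' x) := by
    intro G K y hG hK hy hs x hx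
    refine sub_eq_zero.1 (ident hBc hBo (f := fun x => G (S' x) - y x * K (S' x)) ?_ ha'.2 ?_ x hx)
    · have hGd : Differentiable ℂ G := fun u => (hG u).differentiableAt
      have hKd : Differentiable ℂ K := fun u => (hK u).differentiableAt
      exact (hGd.comp_differentiableOn hS'd).sub (hy.mul (hKd.comp_differentiableOn hS'd))
    · filter_upwards [hfσ, S.ev_ne ha' hH] with x hx hx2
      have hx3 : S' x = σ x := hx.symm
      rw [hx3, hs x hx2.1 hx2.2, sub_self]
  refine ⟨S', ρ z, ρ' z', ⟨hBc, hBo, hS'd, hρd, hρd', ⟨a', ha'.2, by rwa [hS'a]⟩, ?_⟩, hτ a1 ha11, hη a1 ha11⟩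
  intro x hx hHx
  refine ⟨?_, ?_, ?_⟩
  · ext j
    have := key (c.g j) (c.h j) (fun x => x j) (c.ag j) (c.ah j) (by fun_prop) (fun x hx hHx => by
      rw [← div_eq_iff (c.hh _ hHx j)]
      exact congrFun (S.eq x hx hHx).1 j) x hx
    rw [← div_eq_iff (c.hh _ hHx j)] at this
    exact this
  · have := key c.gt c.ht (ρ z) c.agt c.aht hρd (fun x hx hHx => by
      rw [← div_eq_iff (c.hht _ hHx), hτ x hx]
      exact (S.eq x hx hHx).2.1) x hx
    rw [← div_eq_iff (c.hht _ hHx)] at this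
    exact this
  · have := key (fun u => c.g c.k (u + c.b)) (fun u => c.h c.k (u + c.b)) (ρ' z') (tr_an (c.ag c.k) c.b)
      (tr_an (c.ah c.k) c.b) hρd' (fun x hx hHx => by
      rw [← div_eq_iff (c.hhs _ hHx), hη x hx]
      exact (S.eq x hx hHx).2.2) x hx
    rw [← div_eq_iff (c.hhs _ hHx)] at this
    exact this

end Core

end Part3

section Part4
open MvPolynomial Filter Topology

namespace Core
variable {n : ℕ} (c : Core n)

/-- value of a section -/
def IsSec (a : Fin n → ℂ) (t y : ℂ) : Prop :=
  ∃ s σ τ η, c.SecOn s σ τ η ∧ a ∈ s ∧ τ a = t ∧ η a = y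

open Classical in
/-- values of `θ` over `a` -/
noncomputable def Z (a : Fin n → ℂ) : Finset ℂ := (GoodP.rts c.pt a).filter fun t => ∃ y, c.IsSec a t y

open Classical in
/-- values of `ψ` -/
noncomputable def Y (a : Fin n → ℂ) (t : ℂ) : ℂ := if h : ∃ y, c.IsSec a t y then h.choose else 0

variable {c}

theorem IsSec.uniq {a : Fin n → ℂ} {t y y' : ℂ} (hQ : eval a c.Q ≠ 0) (h : c.IsSec a t y) (h' : c.IsSec a t y') :
    y = y' := by
  obtain ⟨s, σ, τ, η, S, ha, ht, hy⟩ := h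
  obtain ⟨s', σ', τ', η', S', ha', ht', hy'⟩ := h'
  rw [← hy, ← hy']
  exact Core.uniq S S' ha ha' hQ (ht.trans ht'.symm)

theorem IsSec.Y_eq {a : Fin n → ℂ} {t y : ℂ} (hQ : eval a c.Q ≠ 0) (h : c.IsSec a t y) : c.Y a t = y := by
  have h' : ∃ y, c.IsSec a t y := ⟨y, h⟩
  unfold Y
  rw [dif_pos h']
  exact IsSec.uniq hQ h'.choose_spec h

theorem IsSec.mem_Z {a : Fin n → ℂ} {t y : ℂ} (hQ : eval a c.Q ≠ 0) (h : c.IsSec a t y) : t ∈ c.Z a := by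
  classical
  refine Finset.mem_filter.2 ⟨?_, y, h⟩
  obtain ⟨s, σ, τ, η, S, ha, ht, hy⟩ := h
  rw [c.gpt.mem_rts hQ, ← ht]
  exact S.root_t ha

theorem Z_isSec {a : Fin n → ℂ} {t : ℂ} (hQ : eval a c.Q ≠ 0) (h : t ∈ c.Z a) : c.IsSec a t (c.Y a t) := by
  classical
  obtain ⟨y, hy⟩ := (Finset.mem_filter.1 h).2
  rwa [hy.Y_eq hQ]

theorem Z_root {a : Fin n → ℂ} {t : ℂ} (hQ : eval a c.Q ≠ 0) (h : t ∈ c.Z a) : ev c.pt a t = 0 := by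
  obtain ⟨s, σ, τ, η, S, ha, ht, hy⟩ := Z_isSec hQ h
  rw [← ht]
  exact S.root_t ha

theorem Y_root {a : Fin n → ℂ} {t : ℂ} (hQ : eval a c.Q ≠ 0) (h : t ∈ c.Z a) : ev c.ps a (c.Y a t) = 0 := by
  obtain ⟨s, σ, τ, η, S, ha, ht, hy⟩ := Z_isSec hQ h
  rw [← hy]
  exact S.root_s ha

theorem card_Z {a : Fin n → ℂ} (hQ : eval a c.Q ≠ 0) : (c.Z a).card ≤ c.pt.natDegree := by
  classical
  rw [← c.gpt.card_rts hQ]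
  exact Finset.card_filter_le _ _

theorem local_Z {a : Fin n → ℂ} (hQ : eval a c.Q ≠ 0) :
    ∃ (r : ℝ) (ρ η : ℂ → (Fin n → ℂ) → ℂ), 0 < r ∧ (∀ z ∈ c.Z a, DifferentiableOn ℂ (ρ z) (Metric.ball a r) ∧
      DifferentiableOn ℂ (η z) (Metric.ball a r)) ∧ ∀ x ∈ Metric.ball a r,
        Set.InjOn (fun z => ρ z x) (c.Z a) ∧ c.Z x = (c.Z a).image (fun z => ρ z x) ∧
        ∀ z ∈ c.Z a, c.Y x (ρ z x) = η z x := by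
  classical
  obtain ⟨r1, ρ, hr1, hQb1, hρ1, hroot1⟩ := c.gpt.rootBall hQ
  obtain ⟨r2, hr2, hQb2, hext⟩ := ext_sec hQ
  set r := min r1 r2 with hrdef
  have hr : 0 < r := lt_min hr1 hr2
  have hB1 : Metric.ball a r ⊆ Metric.ball a r1 := Metric.ball_subset_ball (min_le_left _ _)
  have hB2 : Metric.ball a r ⊆ Metric.ball a r2 := Metric.ball_subset_ball (min_le_right _ _)
  have hZr : ∀ z ∈ c.Z a, z ∈ GoodP.rts c.pt a := fun z hz => (Finset.mem_filter.1 hz).1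
  have har : a ∈ Metric.ball a r := Metric.mem_ball_self hr
  have rig : ∀ {σ τ η}, c.SecOn (Metric.ball a r2) σ τ η → ∀ x ∈ Metric.ball a r, τ x = ρ (τ a) x := by
    intro σ τ η S
    replace S := S.restrict (convex_ball a r) Metric.isOpen_ball hB2 ⟨a, har⟩
    obtain ⟨z, hz, h⟩ := ident_prod S.cvx S.opn ⟨a, har⟩ (fun z x => ρ z x - τ x) (GoodP.rts c.pt a)
      (fun z hz x hx => ((hρ1 z hz).2 x (hB1 hx)).differentiableAt.differentiableWithinAt.sub (S.dτ x hx))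
      (fun x hx => by
        obtain ⟨z, hz, h⟩ := (hroot1 x (hB1 hx)).2.2 _ (S.root_t hx)
        exact ⟨z, hz, sub_eq_zero.2 h⟩)
    have h1 : τ a = z := by rw [← (hρ1 z hz).1, sub_eq_zero.1 (h a har)]
    intro x hx
    rw [h1, sub_eq_zero.1 (h x hx)]
  have hsec : ∀ z, ∃ η, z ∈ c.Z a → ∃ σ τ, c.SecOn (Metric.ball a r2) σ τ η ∧ τ a = z := by
    intro z
    by_cases hz : z ∈ c.Z a
    · obtain ⟨s, σ, τ, η, S, ha, ht, hy⟩ := Z_isSec hQ hz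
      obtain ⟨σ', τ', η', S', e1, e2⟩ := hext s σ τ η S a ha (hB2 har)
      exact ⟨η', fun _ => ⟨σ', τ', S', e1.trans ht⟩⟩
    · exact ⟨0, fun h => absurd h hz⟩
  choose η hη using hsec
  refine ⟨r, ρ, η, hr, ?_, ?_⟩
  · intro z hz
    obtain ⟨σ, τ, S, e⟩ := hη z hz
    exact ⟨fun x hx => ((hρ1 z (hZr z hz)).2 x (hB1 hx)).differentiableAt.differentiableWithinAt, S.dη.mono hB2⟩
  · intro x hx
    have hQx := hQb1 x (hB1 hx)
    have hs : ∀ z ∈ c.Z a, c.IsSec x (ρ z x) (η z x) := by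
      intro z hz
      obtain ⟨σ, τ, S, e⟩ := hη z hz
      refine ⟨_, σ, τ, η z, S, hB2 hx, ?_, rfl⟩
      rw [rig S x hx, e]
    refine ⟨fun z hz z' hz' h => (hroot1 x (hB1 hx)).1 z (hZr z hz) z' (hZr z' hz') h, ?_, fun z hz => (hs z hz).Y_eq hQx⟩
    ext t
    rw [Finset.mem_image]
    constructor
    · intro ht
      obtain ⟨s, σ, τ, η', S, hxs, ht', hy⟩ := Z_isSec hQx ht
      obtain ⟨σ', τ', η'', S', e1, e2⟩ := hext s σ τ η' S x hxs (hB2 hx)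
      refine ⟨τ' a, ?_, ?_⟩
      · exact IsSec.mem_Z (y := η'' a) hQ ⟨_, σ', τ', η'', S', hB2 har, rfl, rfl⟩
      · rw [← rig S' x hx, e1, ht']
    · rintro ⟨z, hz, rfl⟩
      exact (hs z hz).mem_Z hQx

/-- Lagrange interpolation type sum -/
noncomputable def Lam (c : Core n) (f : (Fin n → ℂ) → ℂ → ℂ) (w : Option (Fin n) → ℂ) : ℂ :=
  ∑ z ∈ c.Z (fun j => w (some j)), f (fun j => w (some j)) z *
    ∏ z' ∈ c.Z (fun j => w (some j)), if z' = z then 1 else (w none - z')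

theorem pr_diff (w : Option (Fin n) → ℂ) :
    DifferentiableAt ℂ (fun w : Option (Fin n) → ℂ => (fun j => w (some j) : Fin n → ℂ)) w := by fun_prop

theorem Lam_diff (f : (Fin n → ℂ) → ℂ → ℂ) (hf : (∀ a t, f a t = c.Y a t) ∨ (∀ a t, f a t = 1))
    (w : Option (Fin n) → ℂ) (hQ : eval (fun j => w (some j)) c.Q ≠ 0) : DifferentiableAt ℂ (c.Lam f) w := by
  classical
  obtain ⟨r, ρ, η, hr, hd, hx⟩ := local_Z hQ
  set a : Fin n → ℂ := fun j => w (some j) with ha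
  have hev : ∀ᶠ w' in 𝓝 w, (fun j => w' (some j)) ∈ Metric.ball a r :=
    (pr_diff w).continuousAt (Metric.ball_mem_nhds a hr)
  have hdd : ∀ g : (Fin n → ℂ) → ℂ, DifferentiableOn ℂ g (Metric.ball a r) →
      DifferentiableAt ℂ (fun w : Option (Fin n) → ℂ => g (fun j => w (some j))) w := fun g hg =>
    DifferentiableAt.comp (g := g) (f := fun w : Option (Fin n) → ℂ => (fun j => w (some j) : Fin n → ℂ)) w
      (hg.differentiableAt (Metric.ball_mem_nhds a hr)) (pr_diff w)
  obtain ⟨f', hf'd, hf'⟩ : ∃ f' : ℂ → (Fin n → ℂ) → ℂ, (∀ z ∈ c.Z a, DifferentiableOn ℂ (f' z) (Metric.ball a r)) ∧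
      ∀ x ∈ Metric.ball a r, ∀ z ∈ c.Z a, f x (ρ z x) = f' z x := by
    rcases hf with hf | hf
    · exact ⟨η, fun z hz => (hd z hz).2, fun x hxb z hz => by rw [hf, (hx x hxb).2.2 z hz]⟩
    · exact ⟨fun _ _ => 1, fun z hz => differentiableOn_const _, fun x hxb z hz => hf _ _⟩
  have heq : c.Lam f =ᶠ[𝓝 w] fun w => ∑ z ∈ c.Z a, f' z (fun j => w (some j)) *
      ∏ z' ∈ c.Z a, if z' = z then 1 else (w none - ρ z' (fun j => w (some j))) := by
    filter_upwards [hev] with w' hw'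
    obtain ⟨hinj, him, -⟩ := hx _ hw'
    unfold Lam
    rw [him, Finset.sum_image hinj]
    refine Finset.sum_congr rfl fun z hz => ?_
    rw [hf' _ hw' z hz, Finset.prod_image hinj]
    congr 1
    refine Finset.prod_congr rfl fun z' hz' => ?_
    have : ρ z' (fun j => w' (some j)) = ρ z (fun j => w' (some j)) ↔ z' = z :=
      ⟨fun h => hinj hz' hz h, fun h => by rw [h]⟩
    simp only [this]
  refine DifferentiableAt.congr_of_eventuallyEq ?_ heq
  refine DifferentiableAt.fun_sum fun z hz => (hdd _ (hf'd z hz)).mul ?_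
  rw [← differentiableWithinAt_univ]
  refine diff_prod fun z' hz' => ?_
  rw [differentiableWithinAt_univ]
  by_cases hzz : z' = z
  · simp only [hzz, if_true]; exact differentiableAt_const _
  · simp only [hzz, if_false]
    exact (differentiableAt_apply none w).sub (hdd _ (hd z' hz').1)

theorem norm_pr (w : Option (Fin n) → ℂ) : ‖(fun j => w (some j) : Fin n → ℂ)‖ ≤ ‖w‖ :=
  (pi_norm_le_iff_of_nonneg (norm_nonneg _)).2 fun j => norm_le_pi_norm w (some j)

theorem Lam_bound (f : (Fin n → ℂ) → ℂ → ℂ) (hf : (∀ a t, f a t = c.Y a t) ∨ (∀ a t, f a t = 1)) :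
    ∃ (C : ℝ) (M : ℕ), ∀ w : Option (Fin n) → ℂ, eval (fun j => w (some j)) c.Q ≠ 0 →
      ‖(eval (fun j => w (some j)) c.Q) ^ (c.pt.natDegree + 1) * c.Lam f w‖ ≤ C * (1 + ‖w‖) ^ M := by
  classical
  obtain ⟨C1, M1, hC1, h1⟩ := poly_growth c.Q
  obtain ⟨C2, M2, hC2, h2⟩ := c.gpt.root_bound
  obtain ⟨C3, M3, hC3, h3⟩ := c.gps.root_bound
  set C := C1 + C2 + C3 with hC
  set M := M1 + M2 + M3 + 1 with hM
  have hC0 : 0 ≤ C := by positivity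
  set m := c.pt.natDegree with hm
  refine ⟨m * C ^ (m + 1), M * (m + 1), ?_⟩
  intro w hQ
  set a : Fin n → ℂ := fun j => w (some j) with ha
  have haw : ‖a‖ ≤ ‖w‖ := norm_pr w
  have hw1 : (1:ℝ) ≤ 1 + ‖w‖ := by linarith [norm_nonneg w]
  set X := C * (1 + ‖w‖) ^ M with hX
  have hle : ∀ (C' : ℝ) (M' : ℕ), 0 ≤ C' → M' ≤ M → C' * (1 + ‖a‖) ^ M' ≤ C' * (1 + ‖w‖) ^ M := by
    intro C' M' h0 hMM
    calc C' * (1 + ‖a‖) ^ M' ≤ C' * (1 + ‖w‖) ^ M' := by gcongr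
      _ ≤ C' * (1 + ‖w‖) ^ M := by gcongr
  have hpos : 0 ≤ (1 + ‖w‖) ^ M := by positivity
  have b1 : ‖eval a c.Q‖ ≤ X :=
    (h1 a).trans ((hle C1 M1 hC1 (by omega)).trans (by rw [hX]; gcongr; linarith))
  have b2 : ∀ z ∈ c.Z a, ‖eval a c.Q * (w none - z)‖ ≤ X := by
    intro z hz
    have e1 : ‖eval a c.Q * w none‖ ≤ C1 * (1 + ‖w‖) ^ M := by
      rw [norm_mul]
      calc ‖eval a c.Q‖ * ‖w none‖ ≤ (C1 * (1 + ‖w‖) ^ M1) * (1 + ‖w‖) := by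
            gcongr
            · exact (h1 a).trans (by gcongr)
            · exact (norm_le_pi_norm w none).trans (by linarith)
        _ = C1 * (1 + ‖w‖) ^ (M1 + 1) := by ring
        _ ≤ _ := by
            gcongr
            omega
    have e2 := (h2 a hQ z (Z_root hQ hz)).trans (hle C2 M2 hC2 (by omega))
    rw [mul_sub]
    refine (norm_sub_le _ _).trans ?_
    have : 0 ≤ C3 * (1 + ‖w‖) ^ M := by positivity
    rw [hX, hC]; nlinarith
  have b3 : ∀ z ∈ c.Z a, ‖eval a c.Q * f a z‖ ≤ X := by
    intro z hz
    rcases hf with hf | hf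
    · rw [hf]
      exact (h3 a hQ _ (Y_root hQ hz)).trans ((hle C3 M3 hC3 (by omega)).trans (by rw [hX]; gcongr; linarith))
    · rw [hf, mul_one]; exact b1
  have hX0 : 0 ≤ X := by positivity
  have hcard := card_Z hQ
  have term : ∀ z ∈ c.Z a, ‖(eval a c.Q) ^ (m + 1) * (f a z * ∏ z' ∈ c.Z a, if z' = z then 1 else (w none - z'))‖
      ≤ X ^ (m + 1) := by
    intro z hz
    have e : (eval a c.Q) ^ (m + 1) * (f a z * ∏ z' ∈ c.Z a, if z' = z then 1 else (w none - z'))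
        = (eval a c.Q) ^ (m - (c.Z a).card) * ((eval a c.Q * f a z) *
          ∏ z' ∈ c.Z a, (eval a c.Q * if z' = z then 1 else (w none - z'))) := by
      rw [Finset.prod_mul_distrib, Finset.prod_const]
      have : m + 1 = (m - (c.Z a).card) + (c.Z a).card + 1 := by omega
      rw [this, pow_succ, pow_add]
      ring
    rw [e, norm_mul, norm_mul, norm_prod, norm_pow]
    have hp : ∏ z' ∈ c.Z a, ‖eval a c.Q * if z' = z then 1 else (w none - z')‖ ≤ X ^ (c.Z a).card := by
      rw [← Finset.prod_const]
      refine Finset.prod_le_prod (fun _ _ => norm_nonneg _) fun z' hz' => ?_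
      split_ifs
      · rw [mul_one]; exact b1
      · exact b2 z' hz'
    calc _ ≤ X ^ (m - (c.Z a).card) * (X * X ^ (c.Z a).card) := by
          gcongr
          exact b3 z hz
      _ = X ^ (m - (c.Z a).card + (c.Z a).card + 1) := by rw [pow_succ, pow_add]; ring
      _ = X ^ (m + 1) := by congr 1; omega
  unfold Lam
  rw [Finset.mul_sum]
  calc _ ≤ ∑ z ∈ c.Z a, X ^ (m + 1) := norm_sum_le_of_le _ term
    _ = (c.Z a).card * X ^ (m + 1) := by rw [Finset.sum_const, nsmul_eq_mul]
    _ ≤ m * X ^ (m + 1) := by gcongr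
    _ = _ := by rw [hX, mul_pow, ← pow_mul, mul_assoc]

theorem Lam_poly (f : (Fin n → ℂ) → ℂ → ℂ) (hf : (∀ a t, f a t = c.Y a t) ∨ (∀ a t, f a t = 1)) :
    ∃ p : MvPolynomial (Option (Fin n)) ℂ, ∀ w, (eval (fun j => w (some j)) c.Q) ^ (c.pt.natDegree + 3) * c.Lam f w
      = eval w p := by
  obtain ⟨C, M, hb⟩ := Lam_bound f hf
  have hr : ∀ w : Option (Fin n) → ℂ, eval w (rename some c.Q) = eval (fun j => w (some j)) c.Q := fun w => by
    rw [eval_rename]; rfl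
  obtain ⟨p, hp⟩ := liouville_off (fun w => (eval (fun j => w (some j)) c.Q) ^ (c.pt.natDegree + 1) * c.Lam f w)
    (rename some c.Q) (fun w hw => by
      rw [hr] at hw
      refine DifferentiableAt.mul (DifferentiableAt.pow ?_ _) (Lam_diff f hf w hw)
      exact DifferentiableAt.comp (g := fun a : Fin n → ℂ => eval a c.Q)
        (f := fun w : Option (Fin n) → ℂ => (fun j => w (some j) : Fin n → ℂ)) w
        (eval_analyticAt c.Q _).differentiableAt (pr_diff w)) C M
    (fun w hw => hb w (by rwa [hr] at hw))
  refine ⟨p, fun w => ?_⟩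
  rw [← hp, hr]; ring

theorem main (c : Core n) : ∃ C D : MvPolynomial (Option (Fin n)) ℂ, ∀ u, c.H u ≠ 0 →
    eval (fun i : Option (Fin n) => i.elim (c.θ u) fun j => c.Φ u j) D ≠ 0 ∧
    c.ψ u * eval (fun i : Option (Fin n) => i.elim (c.θ u) fun j => c.Φ u j) D
      = eval (fun i : Option (Fin n) => i.elim (c.θ u) fun j => c.Φ u j) C := by
  classical
  obtain ⟨C, hC⟩ := Lam_poly (c := c) c.Y (Or.inl fun _ _ => rfl)
  obtain ⟨D, hD⟩ := Lam_poly (c := c) (fun _ _ => 1) (Or.inr fun _ _ => rfl)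
  refine ⟨C, D, fun u hu => ?_⟩
  have hQ : eval (c.Φ u) c.Q ≠ 0 := c.Qne u hu
  obtain ⟨s, σ, τ, η, S, ha, ht, hy⟩ := exists_sec hu
  have hs : c.IsSec (c.Φ u) (c.θ u) (c.ψ u) := ⟨s, σ, τ, η, S, ha, ht, hy⟩
  have hZ := hs.mem_Z hQ
  have hY := hs.Y_eq hQ
  set w : Option (Fin n) → ℂ := fun i => i.elim (c.θ u) fun j => c.Φ u j with hw
  have hwa : (fun j => w (some j)) = c.Φ u := rfl
  have hL : ∀ f, c.Lam f w = f (c.Φ u) (c.θ u) * ∏ z' ∈ c.Z (c.Φ u), if z' = c.θ u then 1 else (c.θ u - z') := by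
    intro f
    unfold Lam
    rw [hwa, Finset.sum_eq_single_of_mem _ hZ]
    · rfl
    · intro z hz hne
      rw [Finset.prod_eq_zero hZ, mul_zero]
      rw [if_neg hne.symm]
      exact sub_self _
  have hP : (∏ z' ∈ c.Z (c.Φ u), if z' = c.θ u then 1 else (c.θ u - z')) ≠ 0 := by
    rw [Finset.prod_ne_zero_iff]
    intro z hz
    split_ifs with h
    · exact one_ne_zero
    · exact sub_ne_zero.2 (Ne.symm h)
  rw [← hC, ← hD, hL, hL, hwa, hY, one_mul]
  exact ⟨mul_ne_zero (pow_ne_zero _ hQ) hP, by ring⟩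

end Core

end Part4

section Part5
open MvPolynomial Filter Topology

/-- entire function, not identically zero -/
def NZ {n : ℕ} (H : (Fin n → ℂ) → ℂ) : Prop := (∀ u, AnalyticAt ℂ H u) ∧ ∃ u, H u ≠ 0

theorem NZ.mul {n : ℕ} {H K : (Fin n → ℂ) → ℂ} (hH : NZ H) (hK : NZ K) : NZ (fun u => H u * K u) := by
  refine ⟨fun u => (hH.1 u).mul (hK.1 u), ?_⟩
  obtain ⟨u, -, hu⟩ := ident_mul (s := Set.univ) convex_univ isOpen_univ
    (fun u _ => (hH.1 u).differentiableAt.differentiableWithinAt)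
    (fun u _ => (hK.1 u).differentiableAt.differentiableWithinAt)
    (by obtain ⟨u, hu⟩ := hH.2; exact ⟨u, trivial, hu⟩) (by obtain ⟨u, hu⟩ := hK.2; exact ⟨u, trivial, hu⟩)
  exact ⟨u, hu⟩

/-- generic points -/
def genF (n : ℕ) : Filter (Fin n → ℂ) where
  sets := {s | ∃ H : (Fin n → ℂ) → ℂ, NZ H ∧ ∀ u, H u ≠ 0 → u ∈ s}
  univ_sets := ⟨fun _ => 1, ⟨fun u => analyticAt_const, 0, one_ne_zero⟩, fun _ _ => trivial⟩
  sets_of_superset := by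
    rintro s t ⟨H, hH, h⟩ hst
    exact ⟨H, hH, fun u hu => hst (h u hu)⟩
  inter_sets := by
    rintro s t ⟨H, hH, h⟩ ⟨K, hK, k⟩
    exact ⟨_, hH.mul hK, fun u hu => ⟨h u (left_ne_zero_of_mul hu), k u (right_ne_zero_of_mul hu)⟩⟩

theorem genF_iff {n : ℕ} {P : (Fin n → ℂ) → Prop} :
    (∀ᶠ u in genF n, P u) ↔ ∃ H, NZ H ∧ ∀ u, H u ≠ 0 → P u := Iff.rfl

theorem NZ.gen {n : ℕ} {H : (Fin n → ℂ) → ℂ} (hH : NZ H) : ∀ᶠ u in genF n, H u ≠ 0 :=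
  genF_iff.2 ⟨H, hH, fun _ h => h⟩

theorem gen_dense {n : ℕ} {P : (Fin n → ℂ) → Prop} (h : ∀ᶠ u in genF n, P u) (x : Fin n → ℂ) :
    ∃ᶠ u in 𝓝 x, P u := by
  obtain ⟨H, hH, h⟩ := genF_iff.1 h
  refine (ident_dense (s := Set.univ) convex_univ isOpen_univ
    (fun u _ => (hH.1 u).differentiableAt.differentiableWithinAt) ?_ (Set.mem_univ x)).mono fun u hu => h u hu
  obtain ⟨u, hu⟩ := hH.2; exact ⟨u, trivial, hu⟩

variable {n : ℕ}

namespace Mero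
variable {f f' : (Fin n → ℂ) → ℂ}

theorem const (a : ℂ) : Mero (fun _ : Fin n → ℂ => a) :=
  ⟨fun _ => a, fun _ => 1, fun _ => analyticAt_const, fun _ => analyticAt_const, ⟨0, one_ne_zero⟩, fun u _ => by simp⟩

theorem add (hf : Mero f) (hf' : Mero f') : Mero (fun u => f u + f' u) := by
  obtain ⟨g, h, hg, hh, hne, e⟩ := hf
  obtain ⟨g', h', hg', hh', hne', e'⟩ := hf'
  have hz := NZ.mul (H := h) (K := h') ⟨hh, hne⟩ ⟨hh', hne'⟩
  refine ⟨fun u => g u * h' u + h u * g' u, fun u => h u * h' u, fun u => ((hg u).mul (hh' u)).add ((hh u).mul (hg' u)),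
    hz.1, hz.2, fun u hu => ?_⟩
  beta_reduce at hu ⊢
  rw [e u (left_ne_zero_of_mul hu), e' u (right_ne_zero_of_mul hu),
    div_add_div _ _ (left_ne_zero_of_mul hu) (right_ne_zero_of_mul hu)]

theorem mul (hf : Mero f) (hf' : Mero f') : Mero (fun u => f u * f' u) := by
  obtain ⟨g, h, hg, hh, hne, e⟩ := hf
  obtain ⟨g', h', hg', hh', hne', e'⟩ := hf'
  have hz := NZ.mul (H := h) (K := h') ⟨hh, hne⟩ ⟨hh', hne'⟩
  refine ⟨fun u => g u * g' u, fun u => h u * h' u, fun u => (hg u).mul (hg' u),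
    hz.1, hz.2, fun u hu => ?_⟩
  beta_reduce at hu ⊢
  rw [e u (left_ne_zero_of_mul hu), e' u (right_ne_zero_of_mul hu), div_mul_div_comm]

theorem sum {κ : Type*} (S : Finset κ) {F : κ → (Fin n → ℂ) → ℂ} (hF : ∀ i ∈ S, Mero (F i)) :
    Mero (fun u => ∑ i ∈ S, F i u) := by
  classical
  induction S using Finset.induction_on with
  | empty => simpa using Mero.const 0
  | insert z T hz ih =>
    simp only [Finset.sum_insert hz]
    exact (hF z (Finset.mem_insert_self _ _)).add (ih fun z hz => hF z (Finset.mem_insert_of_mem hz))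

theorem prod {κ : Type*} (S : Finset κ) {F : κ → (Fin n → ℂ) → ℂ} (hF : ∀ i ∈ S, Mero (F i)) :
    Mero (fun u => ∏ i ∈ S, F i u) := by
  classical
  induction S using Finset.induction_on with
  | empty => simpa using Mero.const 1
  | insert z T hz ih =>
    simp only [Finset.prod_insert hz]
    exact (hF z (Finset.mem_insert_self _ _)).mul (ih fun z hz => hF z (Finset.mem_insert_of_mem hz))

theorem eval_poly {κ : Type*} (P : MvPolynomial κ ℂ) {F : (Fin n → ℂ) → κ → ℂ} (hF : ∀ i, Mero (fun u => F u i)) :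
    Mero (fun u => eval (F u) P) := by
  induction P using MvPolynomial.induction_on with
  | C a => simpa using Mero.const a
  | add p q hp hq => simpa using hp.add hq
  | mul_X p i hp => simpa using hp.mul (hF i)

theorem det {F : Fin n → Fin n → (Fin n → ℂ) → ℂ} (hF : ∀ i j, Mero (F i j)) :
    Mero (fun u => Matrix.det (Matrix.of fun i j => F i j u)) := by
  simp only [Matrix.det_apply']
  exact Mero.sum _ fun σ _ => (Mero.const _).mul (Mero.prod _ fun i _ => hF _ _)

theorem _root_.fderiv_app_an {f : (Fin n → ℂ) → ℂ} {u : Fin n → ℂ} (hf : AnalyticAt ℂ f u) (p : Fin n) :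
    AnalyticAt ℂ (pd f p) u :=
  ((ContinuousLinearMap.apply ℂ ℂ (Pi.single p (1:ℂ) : Fin n → ℂ)).analyticAt _).comp_of_eq hf.fderiv rfl

theorem _root_.pd_congr {f f' : (Fin n → ℂ) → ℂ} {u : Fin n → ℂ} (h : f =ᶠ[𝓝 u] f') (p : Fin n) : pd f p u = pd f' p u := by
  unfold _root_.pd
  rw [h.fderiv_eq]

theorem ev_eq {g h : (Fin n → ℂ) → ℂ} (hh : ∀ u, AnalyticAt ℂ h u) (e : ∀ u, h u ≠ 0 → f u = g u / h u)
    {u : Fin n → ℂ} (hu : h u ≠ 0) : f =ᶠ[𝓝 u] fun u => g u / h u := by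
  filter_upwards [(hh u).continuousAt.eventually_ne hu] with x hx using e x hx

theorem pd (hf : Mero f) (p : Fin n) : Mero (pd f p) := by
  obtain ⟨g, h, hg, hh, hne, e⟩ := hf
  have hz := NZ.mul (H := h) (K := h) ⟨hh, hne⟩ ⟨hh, hne⟩
  refine ⟨fun u => h u * _root_.pd g p u - g u * _root_.pd h p u, fun u => h u * h u,
    fun u => ((hh u).mul (fderiv_app_an (hg u) p)).sub ((hg u).mul (fderiv_app_an (hh u) p)), hz.1, hz.2, fun u hu => ?_⟩
  have hu' := left_ne_zero_of_mul hu
  rw [pd_congr (ev_eq hh e hu') p]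
  unfold _root_.pd
  have h1 := (hg u).differentiableAt
  have h2 := (hh u).differentiableAt
  have h3 : DifferentiableAt ℂ (fun u => g u / h u) u := ((hg u).div (hh u) hu').differentiableAt
  have h4 : (fun u => (g u / h u) * h u) =ᶠ[𝓝 u] g := by
    filter_upwards [(hh u).continuousAt.eventually_ne hu'] with x hx using div_mul_cancel₀ _ hx
  have h5 := h4.fderiv_eq (𝕜 := ℂ)
  rw [fderiv_fun_mul h3 h2] at h5
  beta_reduce
  rw [← h5]
  simp only [ContinuousLinearMap.add_apply, ContinuousLinearMap.smul_apply, smul_eq_mul]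
  field_simp
  ring

theorem gen_an (hf : Mero f) : ∀ᶠ u in genF n, AnalyticAt ℂ f u := by
  obtain ⟨g, h, hg, hh, hne, e⟩ := hf
  refine genF_iff.2 ⟨h, ⟨hh, hne⟩, fun u hu => ?_⟩
  exact ((hg u).div (hh u) hu).congr (ev_eq hh e hu).symm

theorem gen_ne (hf : Mero f) {u0 : Fin n → ℂ} (hc : ContinuousAt f u0) (h0 : f u0 ≠ 0) : ∀ᶠ u in genF n, f u ≠ 0 := by
  obtain ⟨g, h, hg, hh, hne, e⟩ := hf
  have hz : NZ g := by
    refine ⟨hg, ?_⟩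
    by_contra hcon
    push Not at hcon
    refine h0 (eq_of_dense (g := fun _ => 0) hc continuousAt_const ?_)
    refine (gen_dense (NZ.gen (H := h) ⟨hh, hne⟩) u0).mono fun u hu => ?_
    rw [e u hu, hcon, zero_div]
  filter_upwards [hz.gen, NZ.gen (H := h) ⟨hh, hne⟩] with u h1 h2
  rw [e u h2]
  exact div_ne_zero h1 h2

end Mero

theorem fderiv_pi_apply {φ : Fin n → (Fin n → ℂ) → ℂ} {u : Fin n → ℂ} (h : ∀ j, AnalyticAt ℂ (φ j) u) (x : Fin n → ℂ) :
    fderiv ℂ (fun u j => φ j u) u x = (Matrix.of fun k p => pd (φ k) p u).mulVec x := by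
  ext k
  rw [fderiv_pi (fun j => (h j).differentiableAt)]
  simp only [ContinuousLinearMap.coe_pi', Matrix.mulVec, dotProduct, Matrix.of_apply, pd]
  conv_lhs => rw [pi_eq_sum_univ' x]
  rw [map_sum]
  refine Finset.sum_congr rfl fun p _ => ?_
  rw [map_smul, smul_eq_mul, mul_comm]


theorem alg_indep {φ : Fin n → (Fin n → ℂ) → ℂ} (hmero : ∀ k, Mero (φ k)) (hindep : AnalyticallyIndep φ)
    (Q : MvPolynomial (Fin n) ℂ) (hQ : Q ≠ 0) : ∀ᶠ u in genF n, eval (fun j => φ j u) Q ≠ 0 := by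
  obtain ⟨u0, ha, hdet⟩ := hindep
  have hM : Mero (fun u => eval (fun j => φ j u) Q) := Mero.eval_poly Q hmero
  have haΦ : AnalyticAt ℂ (fun u j => φ j u) u0 := AnalyticAt.pi ha
  have hmap : map (fun u j => φ j u) (𝓝 u0) = 𝓝 (fun j => φ j u0) := by
    have hs : HasStrictFDerivAt (fun u j => φ j u) (fderiv ℂ (fun u j => φ j u) u0) u0 := haΦ.hasStrictFDerivAt
    apply hs.map_nhds_eq_of_surj
    rw [LinearMap.range_eq_top]
    intro y
    refine ⟨(Matrix.of fun k p => pd (φ k) p u0)⁻¹.mulVec y, ?_⟩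
    change fderiv ℂ (fun u j => φ j u) u0 _ = y
    rw [fderiv_pi_apply ha, Matrix.mulVec_mulVec, Matrix.mul_nonsing_inv _ (isUnit_iff_ne_zero.2 hdet), Matrix.one_mulVec]
  have hfr : ∃ᶠ u in 𝓝 u0, eval (fun j => φ j u) Q ≠ 0 := by
    have : ∃ᶠ y in 𝓝 (fun j => φ j u0), eval y Q ≠ 0 := by
      refine ident_dense (s := Set.univ) convex_univ isOpen_univ
        (fun u _ => (eval_analyticAt Q u).differentiableAt.differentiableWithinAt) ?_ (Set.mem_univ _)
      by_contra hcon
      push Not at hcon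
      exact hQ (MvPolynomial.funext fun x => by simpa using hcon x trivial)
    rw [← hmap, frequently_map] at this
    exact this
  obtain ⟨u, hu, hu'⟩ := (hfr.and_eventually haΦ.eventually_analyticAt).exists
  refine hM.gen_ne (u0 := u) ?_ hu
  exact ContinuousAt.comp (g := fun y => eval y Q) (f := fun u j => φ j u) (eval_analyticAt Q _).continuousAt hu'.continuousAt

end Part5

section Part6
open MvPolynomial Filter Topology

/-- regrouping of variables -/
def regr (n : ℕ) : Option (Fin n ⊕ Fin n) → Option (Fin n) ⊕ Fin n
  | none => .inl none
  | some (.inl j) => .inl (some j)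
  | some (.inr j) => .inr j

theorem regr_inj (n : ℕ) : Function.Injective (regr n) := by
  rintro (_ | _ | _) (_ | _ | _) h <;> simp_all [regr]

theorem exists_regr {n : ℕ} (G : MvPolynomial (Option (Fin n ⊕ Fin n)) ℂ) (hG : G ≠ 0) :
    ∃ G' : MvPolynomial (Option (Fin n)) (MvPolynomial (Fin n) ℂ), G' ≠ 0 ∧ ∀ (t : ℂ) (x y : Fin n → ℂ),
      eval (fun i : Option (Fin n) => i.elim t x) (map (eval y) G') = eval (fun i => i.elim t (Sum.elim x y)) G := by
  refine ⟨sumAlgEquiv ℂ _ _ (rename (regr n) G), ?_, fun t x y => ?_⟩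
  · intro h
    apply hG
    rw [map_eq_zero_iff _ (sumAlgEquiv ℂ _ _).injective] at h
    exact (map_eq_zero_iff _ (rename_injective _ (regr_inj n))).1 h
  · induction G using MvPolynomial.induction_on with
    | C a => simp
    | add p q hp hq =>
      by_cases h1 : p = 0
      · by_cases h2 : q = 0
        · simp [h1, h2]
        · simpa [h1] using hq h2
      · by_cases h2 : q = 0
        · simpa [h2] using hp h1
        · simp [hp h1, hq h2]
    | mul_X p i hp =>
      by_cases h1 : p = 0
      · simp [h1]
      · simp only [map_mul, hp h1, rename_X, eval_X]
        congr 1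
        rcases i with _ | _ | _ <;> simp [regr]

theorem aat_spec {n : ℕ} {φ : Fin n → (Fin n → ℂ) → ℂ} (hmero : ∀ k, Mero (φ k)) (hindep : AnalyticallyIndep φ)
    (haat : AdmitsAAT φ) (k : Fin n) (b : Fin n → ℂ) (hb : ∀ j, AnalyticAt ℂ (φ j) b) :
    ∃ P : MvPolynomial (Option (Fin n)) ℂ, P ≠ 0 ∧ ∀ u, (∀ j, AnalyticAt ℂ (φ j) u) → AnalyticAt ℂ (φ k) (u + b) →
      eval (fun i => i.elim (φ k (u + b)) (fun j => φ j u)) P = 0 := by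
  obtain ⟨G, hG1, hG⟩ := haat k
  have hG0 : G ≠ 0 := by rintro rfl; simp at hG1
  obtain ⟨G', hG'0, hG'⟩ := exists_regr G hG0
  let e : (Fin n → ℂ) → (G'.support → ℂ) := fun v m => eval (fun j => φ j v) (coeff m.1 G')
  have hfr : ∃ᶠ v in 𝓝 b, e v ≠ 0 := by
    obtain ⟨m, hm⟩ := MvPolynomial.support_nonempty.2 hG'0
    refine (gen_dense (alg_indep hmero hindep (coeff m G') (mem_support_iff.1 hm)) b).mono fun v hv h => hv ?_
    exact congrFun h ⟨m, hm⟩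
  let N : (Fin n → ℂ) → (G'.support → ℂ) := fun v => ((‖e v‖⁻¹ : ℝ) : ℂ) • e v
  obtain ⟨c, hc, hcl⟩ := (isCompact_sphere (0 : G'.support → ℂ) 1).exists_mapClusterPt_of_frequently (l := 𝓝 b) (f := N)
    (hfr.mono fun v hv => by
      have : ‖e v‖ ≠ 0 := norm_ne_zero_iff.2 hv
      simp [N, norm_smul, this])
  have hc0 : c ≠ 0 := by rintro rfl; simp at hc
  let mo : (Option (Fin n) →₀ ℕ) → (Option (Fin n) → ℂ) → ℂ := fun m x => m.prod fun i a => x i ^ a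
  refine ⟨∑ m : G'.support, monomial m.1 (c m), ?_, fun u hu hub => ?_⟩
  · obtain ⟨m, hm⟩ := Function.ne_iff.1 hc0
    intro h
    apply hm
    have := congrArg (coeff m.1) h
    rw [coeff_sum, Finset.sum_eq_single m] at this
    · simpa using this
    · intro m' _ hne
      rw [coeff_monomial, if_neg (fun h => hne (Subtype.ext h))]
    · simp
  · let F : (Fin n → ℂ) × (G'.support → ℂ) → ℂ := fun w =>
      ∑ m : G'.support, w.2 m * (m.1.prod fun i a => (i.elim (φ k (u + w.1)) (fun j => φ j u) : ℂ) ^ a)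
    have hF : ContinuousAt F (b, c) := by
      have h1 : ContinuousAt (fun w : (Fin n → ℂ) × (G'.support → ℂ) => φ k (u + w.1)) (b, c) :=
        ContinuousAt.comp (g := φ k) (f := fun w : (Fin n → ℂ) × (G'.support → ℂ) => u + w.1) hub.continuousAt (by fun_prop)
      refine tendsto_finsetSum _ fun m _ => ?_
      refine Tendsto.mul (Continuous.tendsto (by fun_prop) _) ?_
      refine tendsto_finsetProd _ fun i _ => ?_
      refine Tendsto.pow ?_ _
      rcases i with _ | i
      · exact h1
      · exact tendsto_const_nhds
    have hz : ∀ᶠ v in 𝓝 b, F (v, N v) = 0 := by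
      have h2 : ∀ᶠ v in 𝓝 b, AnalyticAt ℂ (φ k) (u + v) :=
        (show ContinuousAt (fun v => u + v) b by fun_prop).eventually hub.eventually_analyticAt
      filter_upwards [eventually_all.2 fun j => (hb j).eventually_analyticAt, h2] with v hv hv2
      have h3 := hG u v hu hv hv2
      rw [← hG'] at h3
      have h4 : F (v, N v) = ((‖e v‖⁻¹ : ℝ) : ℂ) * F (v, e v) := by
        simp only [F, N, Finset.mul_sum, Pi.smul_apply, smul_eq_mul, mul_assoc]
      rw [h4, mul_eq_zero]
      right
      rw [← h3]
      conv_rhs => rw [G'.as_sum, map_sum, map_sum]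
      simp only [map_monomial, eval_monomial]
      rw [← Finset.sum_coe_sort]
    have h0 : F (b, c) = 0 := by
      by_contra hne
      have h5 := hF.eventually_ne hne
      rw [nhds_prod_eq] at h5
      obtain ⟨pa, ha, pb, hpb, h6⟩ := eventually_prod_iff.1 h5
      obtain ⟨v, hv1, hv2, hv3⟩ := ((hcl.frequently hpb).and_eventually (hz.and ha)).exists
      exact h6 hv3 hv1 hv2
    rw [← h0, map_sum]
    simp only [eval_monomial, F]

end Part6

section Part7
open MvPolynomial Filter Topology

theorem prep {n : ℕ} (P D : MvPolynomial (Option (Fin n)) ℂ) (hP : P ≠ 0) :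
    ∃ (p : Polynomial (MvPolynomial (Fin n) ℂ)) (Q : MvPolynomial (Fin n) ℂ), Q ≠ 0 ∧ GoodP p Q ∧
      (∀ a t, eval a Q ≠ 0 → eval (fun i : Option (Fin n) => i.elim t a) P = 0 →
        eval (fun i : Option (Fin n) => i.elim t a) D ≠ 0 → ev p a t = 0) ∧
      (∀ a t, eval a Q ≠ 0 → ev p a t = 0 → eval (fun i : Option (Fin n) => i.elim t a) D ≠ 0) := by
  have hP' : optionEquivLeft ℂ (Fin n) P ≠ 0 := by
    rwa [Ne, map_eq_zero_iff _ (optionEquivLeft ℂ (Fin n)).injective]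
  obtain ⟨p, T, U, W, U', W', q, N, hq, hp, e1, e2, e3⟩ := alg_lemma _ (optionEquivLeft ℂ (Fin n) D) hP'
  have hev : ∀ (X : MvPolynomial (Option (Fin n)) ℂ) (a : Fin n → ℂ) (t : ℂ),
      eval (fun i : Option (Fin n) => i.elim t a) X = ev (optionEquivLeft ℂ (Fin n) X) a t := by
    intro X a t
    rw [optionEquivLeft_elim_eval]
    rfl
  have hq' : ∀ a, eval a (q * p.leadingCoeff) ≠ 0 → eval a q ≠ 0 := by
    intro a ha
    rw [map_mul] at ha
    exact left_ne_zero_of_mul ha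
  refine ⟨p, q * p.leadingCoeff, mul_ne_zero hq (Polynomial.leadingCoeff_ne_zero.2 hp), ⟨dvd_mul_left _ _, ?_⟩, ?_, ?_⟩
  · intro a ha
    have h := congrArg (Polynomial.map (eval a)) e2
    simp only [Polynomial.map_add, Polynomial.map_mul, Polynomial.map_C, ← Polynomial.derivative_map] at h
    refine ⟨Polynomial.C (eval a q)⁻¹ * Polynomial.map (eval a) U, Polynomial.C (eval a q)⁻¹ * Polynomial.map (eval a) W, ?_⟩
    rw [mul_assoc, mul_assoc, ← mul_add, h, ← Polynomial.C_mul, inv_mul_cancel₀ (hq' a ha), Polynomial.C_1]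
  · intro a t ha h0 hD
    have h := congrArg (fun X => ev X a t) e1
    rw [hev] at h0 hD
    simp only [ev, Polynomial.map_mul, Polynomial.map_C, Polynomial.map_pow, Polynomial.eval_mul, Polynomial.eval_pow,
      Polynomial.eval_C] at h h0 hD ⊢
    rw [h0, zero_mul] at h
    have h2 := eq_zero_of_pow_eq_zero ((mul_eq_zero.1 h.symm).resolve_left (hq' a ha))
    exact (mul_eq_zero.1 h2).resolve_right hD
  · intro a t ha h0 hD
    have h := congrArg (fun X => ev X a t) e3
    rw [hev] at hD
    simp only [ev, Polynomial.map_mul, Polynomial.map_C, Polynomial.map_add, Polynomial.eval_mul, Polynomial.eval_add,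
      Polynomial.eval_C] at h h0 hD
    rw [h0, hD] at h
    simp at h
    exact hq' a ha h.symm

theorem GoodP.mono {n : ℕ} {p : Polynomial (MvPolynomial (Fin n) ℂ)} {Q Q' : MvPolynomial (Fin n) ℂ} (h : GoodP p Q)
    (hd : Q ∣ Q') : GoodP p Q' :=
  ⟨h.lc.trans hd, fun a ha => h.sep a fun h0 => ha (by
    obtain ⟨R, rfl⟩ := hd
    rw [map_mul, h0, zero_mul])⟩

/-- matrices as continuous linear maps -/
noncomputable def matL (n : ℕ) : (Fin n → Fin n → ℂ) →L[ℂ] ((Fin n → ℂ) →L[ℂ] (Fin n → ℂ)) :=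
  LinearMap.toContinuousLinearMap
    ({ toFun := fun M => LinearMap.toContinuousLinearMap (Matrix.toLin' (Matrix.of M))
       map_add' := fun M M' => by
        ext x i
        simp [Matrix.mulVec, dotProduct, add_mul, Finset.sum_add_distrib, Finset.sum_add_distrib]
       map_smul' := fun r M => by
        ext x i
        simp [Matrix.mulVec, dotProduct, Finset.mul_sum, mul_assoc] } :
      (Fin n → Fin n → ℂ) →ₗ[ℂ] ((Fin n → ℂ) →L[ℂ] (Fin n → ℂ)))

theorem matL_apply {n : ℕ} (M : Fin n → Fin n → ℂ) (x : Fin n → ℂ) : matL n M x = (Matrix.of M).mulVec x := rfl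

theorem elim_an {n : ℕ} (P : MvPolynomial (Option (Fin n)) ℂ) (w : (Fin n → ℂ) × ℂ) :
    AnalyticAt ℂ (fun w : (Fin n → ℂ) × ℂ => eval (fun i : Option (Fin n) => i.elim w.2 w.1) P) w := by
  refine (eval_analyticAt P _).comp_of_eq (f := fun w : (Fin n → ℂ) × ℂ => fun i : Option (Fin n) => i.elim w.2 w.1) ?_ rfl
  refine AnalyticAt.pi fun i => ?_
  rcases i with _ | i
  · exact analyticAt_snd
  · exact ((ContinuousLinearMap.proj (R := ℂ) (φ := fun _ : Fin n => ℂ) i).analyticAt _).comp_of_eq analyticAt_fst rfl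

end Part7

section Part8
open MvPolynomial Filter Topology

theorem mat_inv {n : ℕ} {A J : Matrix (Fin n) (Fin n) ℂ} {β : ℂ} (hβ : β ≠ 0) (hA : A = β • J) (hJ : J.det ≠ 0) :
    A.det ≠ 0 ∧ (A.det⁻¹ • (β • A.adjugate)) * J = 1 ∧ J * (A.det⁻¹ • (β • A.adjugate)) = 1 := by
  have h0 : A.det ≠ 0 := by
    rw [hA, Matrix.det_smul]
    exact mul_ne_zero (pow_ne_zero _ hβ) hJ
  have h1 : (A.det⁻¹ • (β • A.adjugate)) * J = 1 := by
    have : (β • A.adjugate) * J = A.adjugate * A := by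
      conv_rhs => rw [hA, Matrix.mul_smul]
      rw [Matrix.smul_mul, hA]
    rw [Matrix.smul_mul, this, Matrix.adjugate_mul, smul_smul, inv_mul_cancel₀ h0, one_smul]
  exact ⟨h0, h1, mul_eq_one_comm.1 h1⟩

theorem main_thm {n : ℕ} (φ : Fin n → (Fin n → ℂ) → ℂ)
    (hmero : ∀ k, Mero (φ k)) (hindep : AnalyticallyIndep φ) (haat : AdmitsAAT φ)
    (θ : (Fin n → ℂ) → ℂ) (α : Fin n → Fin n → ℂ)
    (hθ : ∀ u, θ u = ∑ k : Fin n, ∑ p : Fin n, α k p * pd (φ k) p u)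
    (V : MvPolynomial (Option (Fin n)) ℂ) (hV0 : V ≠ 0)
    (hV : ∀ u, (∀ j, AnalyticAt ℂ (φ j) u) → (∀ j p, AnalyticAt ℂ (pd (φ j) p) u) →
      eval (tval θ φ u) V = 0)
    (A B : Fin n → Fin n → MvPolynomial (Option (Fin n)) ℂ)
    (hBne : ∀ k p, ∃ u, (∀ j, AnalyticAt ℂ (φ j) u) ∧ (∀ j q, AnalyticAt ℂ (pd (φ j) q) u) ∧
      eval (tval θ φ u) (B k p) ≠ 0)
    (hAB : ∀ k p u, (∀ j, AnalyticAt ℂ (φ j) u) → (∀ j q, AnalyticAt ℂ (pd (φ j) q) u) →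
      eval (tval θ φ u) (B k p) ≠ 0 →
      pd (φ k) p u = eval (tval θ φ u) (A k p) / eval (tval θ φ u) (B k p))
    (k : Fin n) (b : Fin n → ℂ) (hb : ∀ j, AnalyticAt ℂ (φ j) b) :
    ∃ C D : MvPolynomial (Option (Fin n)) ℂ,
      (∃ u : Fin n → ℂ, (∀ j, AnalyticAt ℂ (φ j) u) ∧
        (∀ j q, AnalyticAt ℂ (pd (φ j) q) u) ∧ AnalyticAt ℂ (φ k) (u + b) ∧
        eval (tval θ φ u) D ≠ 0) ∧
      ∀ u : Fin n → ℂ, (∀ j, AnalyticAt ℂ (φ j) u) →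
        (∀ j q, AnalyticAt ℂ (pd (φ j) q) u) → AnalyticAt ℂ (φ k) (u + b) →
        eval (tval θ φ u) D ≠ 0 →
        φ k (u + b) = eval (tval θ φ u) C / eval (tval θ φ u) D := by
  classical
  have hθ' : θ = fun u => ∑ k : Fin n, ∑ p : Fin n, α k p * pd (φ k) p u := funext hθ
  have hθM : Mero θ := by
    rw [hθ']
    exact Mero.sum _ fun i _ => Mero.sum _ fun p _ => (Mero.const _).mul ((hmero i).pd p)
  have hθc : ∀ u, (∀ j q, AnalyticAt ℂ (pd (φ j) q) u) → ContinuousAt θ u := by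
    intro u hu
    rw [hθ']
    exact tendsto_finsetSum _ fun i _ => tendsto_finsetSum _ fun p _ => (hu i p).continuousAt.const_mul (α i p)
  have htc : ∀ (X : MvPolynomial (Option (Fin n)) ℂ) u, (∀ j, AnalyticAt ℂ (φ j) u) →
      (∀ j q, AnalyticAt ℂ (pd (φ j) q) u) → ContinuousAt (fun u => eval (tval θ φ u) X) u := by
    intro X u h1 h2
    refine ContinuousAt.comp (g := fun y => eval y X) (f := fun u => tval θ φ u) (eval_analyticAt X _).continuousAt ?_
    refine continuousAt_pi.2 fun i => ?_
    rcases i with _ | j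
    · exact hθc u h2
    · exact (h1 j).continuousAt
  have htM : ∀ X : MvPolynomial (Option (Fin n)) ℂ, Mero (fun u => eval (tval θ φ u) X) := by
    intro X
    refine Mero.eval_poly X fun i => ?_
    rcases i with _ | j
    · exact hθM
    · exact hmero j
  -- the polynomial matrices
  let Bt : MvPolynomial (Option (Fin n)) ℂ := ∏ x : Fin n × Fin n, B x.1 x.2
  let Am : Matrix (Fin n) (Fin n) (MvPolynomial (Option (Fin n)) ℂ) :=
    Matrix.of fun i p => A i p * ∏ x ∈ Finset.univ.erase (i, p), B x.1 x.2
  obtain ⟨P, hP0, hP⟩ := aat_spec hmero hindep haat k b hb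
  obtain ⟨pt, Q1, hQ1, g1, r1, d1⟩ := prep V Am.det hV0
  obtain ⟨ps, Q2, hQ2, g2, r2, -⟩ := prep P 1 hP0
  -- generic facts
  have hgen1 : ∀ᶠ u in genF n, ∀ j, AnalyticAt ℂ (φ j) u := eventually_all.2 fun j => (hmero j).gen_an
  have hgen2 : ∀ᶠ u in genF n, ∀ j q, AnalyticAt ℂ (pd (φ j) q) u := by
    filter_upwards [hgen1] with u hu j q using fderiv_app_an (hu j) q
  have hgen3 : ∀ᶠ u in genF n, ∀ i p, eval (tval θ φ u) (B i p) ≠ 0 := by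
    refine eventually_all.2 fun i => eventually_all.2 fun p => ?_
    obtain ⟨u0, h1, h2, h3⟩ := hBne i p
    exact (htM _).gen_ne (htc _ _ h1 h2) h3
  have hgen4 : ∀ᶠ u in genF n, Matrix.det (Matrix.of fun k p => pd (φ k) p u) ≠ 0 := by
    obtain ⟨u0, h1, h2⟩ := hindep
    refine (Mero.det fun i j => (hmero i).pd j).gen_ne (u0 := u0) ?_ h2
    simp only [Matrix.det_apply']
    exact tendsto_finsetSum _ fun σ _ => Tendsto.mul tendsto_const_nhds
      (tendsto_finsetProd _ fun i _ => (fderiv_app_an (h1 _) _).continuousAt)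
  have hgen5 := alg_indep hmero hindep (Q1 * Q2) (mul_ne_zero hQ1 hQ2)
  choose g h hg hh hne he using hmero
  obtain ⟨gt, ht, hgt, hht, hnet, het⟩ := hθM
  have hgen6 : ∀ᶠ u in genF n, ∀ j, h j u ≠ 0 := eventually_all.2 fun j => NZ.gen ⟨hh j, hne j⟩
  have hgen7 : ∀ᶠ u in genF n, ht u ≠ 0 := NZ.gen ⟨hht, hnet⟩
  have hgen8 : ∀ᶠ u in genF n, h k (u + b) ≠ 0 := by
    refine NZ.gen (H := fun u => h k (u + b)) ⟨fun u => Core.tr_an (hh k) b u, ?_⟩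
    obtain ⟨u, hu⟩ := hne k
    exact ⟨u - b, by simpa using hu⟩
  obtain ⟨H, hH, hall⟩ := genF_iff.1 (hgen1.and <| hgen2.and <| hgen3.and <| hgen4.and <| hgen5.and <| hgen6.and <|
    hgen7.and hgen8)
  have hq : ∀ u, H u ≠ 0 → quo g h u = fun j => φ j u := by
    intro u hu
    obtain ⟨-, -, -, -, -, h6, -, -⟩ := hall u hu
    funext j
    exact (he j u (h6 j)).symm
  have hqt : ∀ u, H u ≠ 0 → gt u / ht u = θ u := by
    intro u hu
    obtain ⟨-, -, -, -, -, -, h7, -⟩ := hall u hu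
    exact (het u h7).symm
  have hqs : ∀ u, H u ≠ 0 → g k (u + b) / h k (u + b) = φ k (u + b) := by
    intro u hu
    obtain ⟨-, -, -, -, -, -, -, h8⟩ := hall u hu
    exact (he k _ h8).symm
  have hks : ∀ u, H u ≠ 0 → AnalyticAt ℂ (φ k) (u + b) := by
    intro u hu
    obtain ⟨-, -, -, -, -, -, -, h8⟩ := hall u hu
    exact ((hg k _).div (hh k _) h8).congr (Mero.ev_eq (hh k) (he k) h8).symm
  let Mf : (Fin n → ℂ) × ℂ → ((Fin n → ℂ) →L[ℂ] (Fin n → ℂ)) := fun w => matL n fun i p =>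
    (eval (fun i : Option (Fin n) => i.elim w.2 w.1) Am.det)⁻¹ *
      eval (fun i : Option (Fin n) => i.elim w.2 w.1) (Bt * Am.adjugate i p)
  have hQ : ∀ {a}, eval a (Q1 * Q2) ≠ 0 → eval a Q1 ≠ 0 ∧ eval a Q2 ≠ 0 := by
    intro a ha
    rw [map_mul] at ha
    exact ⟨left_ne_zero_of_mul ha, right_ne_zero_of_mul ha⟩
  have hJ : ∀ u, H u ≠ 0 → eval (tval θ φ u) Am.det ≠ 0 ∧
      Mf (quo g h u, gt u / ht u) ∘L fderiv ℂ (quo g h) u = .id ℂ _ ∧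
      fderiv ℂ (quo g h) u ∘L Mf (quo g h u, gt u / ht u) = .id ℂ _ := by
    intro u hu
    obtain ⟨h1, h2, h3, h4, -, -, -, -⟩ := hall u hu
    set ε := eval (tval θ φ u) with hε
    have hBt : ε Bt ≠ 0 := by
      simp only [Bt, map_prod]
      exact Finset.prod_ne_zero_iff.2 fun x _ => h3 _ _
    have hA : ε.mapMatrix Am = ε Bt • Matrix.of fun k p => pd (φ k) p u := by
      ext i p
      simp only [RingHom.mapMatrix_apply, Matrix.map_apply, Matrix.smul_apply, Matrix.of_apply, Am, smul_eq_mul, Bt]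
      rw [hAB i p u h1 h2 (h3 i p), ← Finset.mul_prod_erase Finset.univ (fun x : Fin n × Fin n => B x.1 x.2) (Finset.mem_univ (i, p)),
        map_mul, map_mul, ← hε]
      have := h3 i p
      field_simp
    obtain ⟨m1, m2, m3⟩ := mat_inv hBt hA h4
    have hM : ∀ x, Mf (quo g h u, gt u / ht u) x =
        ((ε.mapMatrix Am).det⁻¹ • (ε Bt • (ε.mapMatrix Am).adjugate)).mulVec x := by
      intro x
      rw [hq u hu, hqt u hu]
      refine congrArg (fun M : Matrix (Fin n) (Fin n) ℂ => M.mulVec x) ?_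
      funext i p
      change (ε Am.det)⁻¹ * ε (Bt * Am.adjugate i p) = _
      rw [← RingHom.map_det, ← RingHom.map_adjugate, map_mul]
      rfl
    have hD : ∀ x, fderiv ℂ (quo g h) u x = (Matrix.of fun k p => pd (φ k) p u).mulVec x := by
      intro x
      have : quo g h =ᶠ[𝓝 u] fun u j => φ j u := by
        filter_upwards [(hH.1 u).continuousAt.eventually_ne hu] with y hy using hq y hy
      rw [this.fderiv_eq, fderiv_pi_apply h1]
    refine ⟨by rw [RingHom.map_det]; exact m1, ?_, ?_⟩
    · ext1 x
      rw [ContinuousLinearMap.comp_apply, hM, hD, Matrix.mulVec_mulVec, m2, Matrix.one_mulVec]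
      rfl
    · ext1 x
      rw [ContinuousLinearMap.comp_apply, hM, hD, Matrix.mulVec_mulVec, m3, Matrix.one_mulVec]
      rfl
  let c : Core n :=
    { g := g, h := h, gt := gt, ht := ht, H := H, k := k, b := b
      ag := hg, ah := hh, agt := hgt, aht := hht
      dH := fun u => (hH.1 u).differentiableAt
      Hne := hH.2
      hh := fun u hu => (hall u hu).2.2.2.2.2.1
      hht := fun u hu => (hall u hu).2.2.2.2.2.2.1
      hhs := fun u hu => (hall u hu).2.2.2.2.2.2.2
      pt := pt, ps := ps, Q := Q1 * Q2
      gpt := g1.mono (dvd_mul_right _ _)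
      gps := g2.mono (dvd_mul_left _ _)
      Qne := fun u hu => by rw [hq u hu]; exact (hall u hu).2.2.2.2.1
      rt := fun u hu => by
        rw [hq u hu, hqt u hu]
        exact r1 _ _ (hQ (hall u hu).2.2.2.2.1).1 (hV u (hall u hu).1 (hall u hu).2.1) (hJ u hu).1
      rs := fun u hu => by
        rw [hq u hu, hqs u hu]
        exact r2 _ _ (hQ (hall u hu).2.2.2.2.1).2 (hP u (hall u hu).1 (hks u hu)) (by simp)
      Mf := Mf
      aMf := fun a t ha h0 => by
        refine ((matL n).analyticAt _).comp_of_eq ?_ rfl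
        refine AnalyticAt.pi fun i => AnalyticAt.pi fun p => ?_
        exact ((elim_an Am.det (a, t)).inv (d1 a t (hQ ha).1 h0)).mul (elim_an _ _)
      Ml := fun u hu => (hJ u hu).2.1
      Mr := fun u hu => (hJ u hu).2.2 }
  obtain ⟨C, D, hCD⟩ := c.main
  have hCD' : ∀ u, H u ≠ 0 → eval (tval θ φ u) D ≠ 0 ∧ φ k (u + b) * eval (tval θ φ u) D = eval (tval θ φ u) C := by
    intro u hu
    have h1 := hCD u hu
    have h2 : (fun i : Option (Fin n) => i.elim (c.θ u) fun j => c.Φ u j) = tval θ φ u := by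
      funext i
      rcases i with _ | j
      · exact hqt u hu
      · exact congrFun (hq u hu) j
    have h3 : c.ψ u = φ k (u + b) := hqs u hu
    rwa [h2, h3] at h1
  refine ⟨C, D, ?_, fun u h1 h2 h3 h4 => ?_⟩
  · obtain ⟨u, hu⟩ := hH.2
    exact ⟨u, (hall u hu).1, (hall u hu).2.1, hks u hu, (hCD' u hu).1⟩
  · rw [eq_div_iff h4]
    refine eq_of_dense (f := fun u => φ k (u + b) * eval (tval θ φ u) D) (g := fun u => eval (tval θ φ u) C) ?_ (htc C u h1 h2) ?_
    · refine ContinuousAt.mul ?_ (htc D u h1 h2)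
      exact ContinuousAt.comp (g := φ k) (f := fun u => u + b) h3.continuousAt (by fun_prop)
    · exact (gen_dense hH.gen u).mono fun y hy => (hCD' y hy).2

end Part8

theorem aat_translate_rational_in_theta {n : ℕ} (hn : 1 ≤ n) (φ : Fin n → (Fin n → ℂ) → ℂ)
    (hmero : ∀ k, Mero (φ k)) (hindep : AnalyticallyIndep φ) (haat : AdmitsAAT φ)
    (θ : (Fin n → ℂ) → ℂ) (α : Fin n → Fin n → ℂ)
    (hθ : ∀ u, θ u = ∑ k : Fin n, ∑ p : Fin n, α k p * pd (φ k) p u)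
    (V : MvPolynomial (Option (Fin n)) ℂ) (hV0 : V ≠ 0)
    (hV : ∀ u, (∀ j, AnalyticAt ℂ (φ j) u) → (∀ j p, AnalyticAt ℂ (pd (φ j) p) u) →
      eval (tval θ φ u) V = 0)
    (A B : Fin n → Fin n → MvPolynomial (Option (Fin n)) ℂ)
    (hBne : ∀ k p, ∃ u, (∀ j, AnalyticAt ℂ (φ j) u) ∧ (∀ j q, AnalyticAt ℂ (pd (φ j) q) u) ∧
      eval (tval θ φ u) (B k p) ≠ 0)
    (hAB : ∀ k p u, (∀ j, AnalyticAt ℂ (φ j) u) → (∀ j q, AnalyticAt ℂ (pd (φ j) q) u) →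
      eval (tval θ φ u) (B k p) ≠ 0 →
      pd (φ k) p u = eval (tval θ φ u) (A k p) / eval (tval θ φ u) (B k p))
    (k : Fin n) (b : Fin n → ℂ) (hb : ∀ j, AnalyticAt ℂ (φ j) b) :
    ∃ C D : MvPolynomial (Option (Fin n)) ℂ,
      (∃ u : Fin n → ℂ, (∀ j, AnalyticAt ℂ (φ j) u) ∧
        (∀ j q, AnalyticAt ℂ (pd (φ j) q) u) ∧ AnalyticAt ℂ (φ k) (u + b) ∧
        eval (tval θ φ u) D ≠ 0) ∧
      ∀ u : Fin n → ℂ, (∀ j, AnalyticAt ℂ (φ j) u) →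
        (∀ j q, AnalyticAt ℂ (pd (φ j) q) u) → AnalyticAt ℂ (φ k) (u + b) →
        eval (tval θ φ u) D ≠ 0 →
        φ k (u + b) = eval (tval θ φ u) C / eval (tval θ φ u) D := by
  exact main_thm φ hmero hindep haat θ α hθ V hV0 hV A B hBne hAB k b hb
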